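/- arXiv:2101.09166 — 7 statements merged into one kernel-verified Lean document; each statement's English description precedes it below -/
import Mathlib

section
/- Let t₁ ∈ ℝ and let f, g, h be continuous real-valued functions on [t₁,∞) with f(t) ≥ 0 for all t ≥ t₁. If y is a continuously differentiable solution of the Riccati equation y' + f(t)y² + g(t)y + h(t) = 0 on all of [t₁,∞), then for every t ≥ t₁: ∫_{t₁}^{t} f(τ)y(τ) dτ ≤ y(t₁)·∫_{t₁}^{t} f(τ) exp(−∫_{t₁}^{τ} g(s) ds) dτ − ∫_{t₁}^{t} f(τ) [∫_{t₁}^{τ} exp(−∫_{ξ}^{τ} g(s) ds) h(ξ) dξ] dτ. -/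
open Set

/-- Multiplying a Riccati equation by the integrating factor `exp (∫ g)` and dropping the quadratic
term bounds a solution by the solution of the associated linear equation. -/
theorem riccati_le_linear_solution {t₁ : ℝ} {f g h y : ℝ → ℝ}
    (hg : Continuous g) (hh : Continuous h) (hfpos : ∀ t ∈ Ici t₁, 0 ≤ f t)
    (hy : ∀ t ∈ Ici t₁, HasDerivAt y (-(f t * y t ^ 2) - g t * y t - h t) t)
    {τ : ℝ} (hτ : τ ∈ Ici t₁) :
    y τ ≤ Real.exp (-∫ s in t₁..τ, g s) *
      (y t₁ - ∫ ξ in t₁..τ, Real.exp (∫ s in t₁..ξ, g s) * h ξ) := by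
  have hG (t : ℝ) : HasDerivAt (fun t => ∫ s in t₁..t, g s) (g t) t :=
    hg.integral_hasStrictDerivAt t₁ t |>.hasDerivAt
  have hGc : Continuous (fun t => ∫ s in t₁..t, g s) :=
    continuous_iff_continuousAt.2 fun t => (hG t).continuousAt
  have hH (t : ℝ) := ((Real.continuous_exp.comp hGc).mul hh).integral_hasStrictDerivAt t₁ t
    |>.hasDerivAt
  have hφ (t : ℝ) (ht : t ∈ Ici t₁) := ((hG t).exp.mul (hy t ht)).add (hH t)
  have hanti := antitoneOn_of_hasDerivWithinAt_nonpos (convex_Ici t₁)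
    (fun t ht => (hφ t ht).continuousAt.continuousWithinAt)
    (fun t ht => (hφ t (interior_subset ht)).hasDerivWithinAt)
    (fun t ht => by
      have hft := mul_nonneg (Real.exp_pos (∫ s in t₁..t, g s)).le
        (mul_nonneg (hfpos t (interior_subset ht)) (sq_nonneg (y t)))
      simp only [Function.comp_apply, Pi.mul_apply]
      linarith)
  have key := hanti self_mem_Ici hτ hτ
  simp only [Pi.add_apply, Pi.mul_apply, Function.comp_apply, intervalIntegral.integral_same,
    Real.exp_zero, one_mul, add_zero] at key
  calc y τ = Real.exp (-∫ s in t₁..τ, g s) * (Real.exp (∫ s in t₁..τ, g s) * y τ) := by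
        rw [← mul_assoc, ← Real.exp_add, neg_add_cancel, Real.exp_zero, one_mul]
    _ ≤ _ := mul_le_mul_of_nonneg_left (by linarith) (Real.exp_pos _).le

/-- The integral estimate for coefficients that are continuous on the whole line. -/
theorem riccati_integral_estimate_of_continuous {t₁ : ℝ} {f g h y : ℝ → ℝ}
    (hf : Continuous f) (hg : Continuous g) (hh : Continuous h)
    (hfpos : ∀ t ∈ Ici t₁, 0 ≤ f t)
    (hy : ∀ t ∈ Ici t₁, HasDerivAt y (-(f t * y t ^ 2) - g t * y t - h t) t)
    {t : ℝ} (ht : t ∈ Ici t₁) :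
    (∫ τ in t₁..t, f τ * y τ) ≤
      y t₁ * (∫ τ in t₁..t, f τ * Real.exp (-∫ s in t₁..τ, g s)) -
        ∫ τ in t₁..t, f τ * ∫ ξ in t₁..τ, Real.exp (-∫ s in ξ..τ, g s) * h ξ := by
  have hGc : Continuous (fun t => ∫ s in t₁..t, g s) :=
    intervalIntegral.continuous_primitive (fun a b => hg.intervalIntegrable a b) t₁
  have hHc : Continuous (fun τ => ∫ ξ in t₁..τ, Real.exp (∫ s in t₁..ξ, g s) * h ξ) :=
    intervalIntegral.continuous_primitive
      (fun a b => ((Real.continuous_exp.comp hGc).mul hh).intervalIntegrable a b) t₁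
  have hinner (τ : ℝ) : (∫ ξ in t₁..τ, Real.exp (-∫ s in ξ..τ, g s) * h ξ) =
      Real.exp (-∫ s in t₁..τ, g s) * ∫ ξ in t₁..τ, Real.exp (∫ s in t₁..ξ, g s) * h ξ := by
    rw [← intervalIntegral.integral_const_mul]
    congr 1 with ξ
    rw [← mul_assoc, ← Real.exp_add,
      ← intervalIntegral.integral_interval_sub_left (hg.intervalIntegrable t₁ τ)
        (hg.intervalIntegrable t₁ ξ)]
    ring_nf
  have hyc : ContinuousOn y (uIcc t₁ t) := fun x hx =>
    (hy x (uIcc_of_le (mem_Ici.1 ht) ▸ hx).1).continuousAt.continuousWithinAt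
  simp_rw [hinner]
  rw [← intervalIntegral.integral_const_mul, ← intervalIntegral.integral_sub
    (Continuous.intervalIntegrable (by fun_prop) _ _)
    (Continuous.intervalIntegrable (by fun_prop) _ _)]
  refine intervalIntegral.integral_mono_on ht (hf.continuousOn.mul hyc).intervalIntegrable
    (Continuous.intervalIntegrable (by fun_prop) _ _) fun τ hτ => ?_
  have hle := mul_le_mul_of_nonneg_left (riccati_le_linear_solution hg hh hfpos hy hτ.1)
    (hfpos τ hτ.1)
  linarith

/-- **Lemma 2.1**. If `y` is a `t₁`-regular solution of the Riccati equation
`y' + f y² + g y + h = 0` with `f ≥ 0` on `[t₁,∞)`, then for all `t ≥ t₁`,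
`∫_{t₁}^t f y ≤ y(t₁) ∫_{t₁}^t f(τ) exp(−∫_{t₁}^τ g) dτ
  − ∫_{t₁}^t f(τ) (∫_{t₁}^τ exp(−∫_ξ^τ g) h(ξ) dξ) dτ`. -/
theorem riccati_integral_estimate
    (t₁ : ℝ) (f g h : ℝ → ℝ)
    (hf : ContinuousOn f (Ici t₁)) (hg : ContinuousOn g (Ici t₁))
    (hh : ContinuousOn h (Ici t₁))
    (hfpos : ∀ t ∈ Ici t₁, 0 ≤ f t)
    (y : ℝ → ℝ)
    (hy : ∀ t ∈ Ici t₁, HasDerivAt y (-(f t * y t ^ 2) - g t * y t - h t) t) :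
    ∀ t ∈ Ici t₁,
      (∫ τ in t₁..t, f τ * y τ) ≤
        y t₁ * (∫ τ in t₁..t, f τ * Real.exp (-∫ s in t₁..τ, g s)) -
          ∫ τ in t₁..t, f τ * ∫ ξ in t₁..τ, Real.exp (-∫ s in ξ..τ, g s) * h ξ := by
  intro t ht
  have hext {u : ℝ → ℝ} (hu : ContinuousOn u (Ici t₁)) : Continuous fun x => u (max t₁ x) :=
    hu.comp_continuous (by fun_prop) fun x => le_max_left t₁ x
  have key := riccati_integral_estimate_of_continuous (hext hf) (hext hg) (hext hh)
    (fun x _ => hfpos _ (le_max_left t₁ x))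
    (fun x hx => by simpa only [max_eq_right (mem_Ici.1 hx)] using hy x hx) ht
  have hcongr {a b : ℝ} (ha : t₁ ≤ a) (hab : a ≤ b) {u v : ℝ → ℝ}
      (huv : ∀ x, t₁ ≤ x → a ≤ x → x ≤ b → u x = v x) :
      (∫ x in a..b, u x) = ∫ x in a..b, v x :=
    intervalIntegral.integral_congr fun x hx => by
      rw [uIcc_of_le hab] at hx
      exact huv x (ha.trans hx.1) hx.1 hx.2
  have hgint {a b : ℝ} (ha : t₁ ≤ a) (hab : a ≤ b) :
      (∫ s in a..b, g (max t₁ s)) = ∫ s in a..b, g s :=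
    hcongr ha hab fun s hs _ _ => by rw [max_eq_right hs]
  convert key using 1
  · refine hcongr le_rfl ht fun x hx _ _ => ?_
    rw [max_eq_right hx]
  · refine congrArg₂ (· - ·) (congrArg (y t₁ * ·) ?_) ?_
    · refine hcongr le_rfl ht fun x hx _ _ => ?_
      rw [max_eq_right hx, hgint le_rfl hx]
    · refine hcongr le_rfl ht fun x hx _ _ => ?_
      rw [max_eq_right hx]
      refine congrArg (f x * ·) (hcongr le_rfl hx fun ξ hξ _ hξx => ?_)
      rw [max_eq_right hξ, hgint hξ hξx]
end

section
/- Let t₀ ∈ ℝ and let g, h be continuous real-valued functions on [t₀,∞). Assume that ∫_{t₀}^{t} g(τ) dτ → +∞ as t → +∞, and that the function t ↦ ∫_{t₀}^{t} exp(−∫_{τ}^{t} g(s) ds) |h(τ)| dτ is bounded on [t₀,∞). Then for every continuous real-valued function φ on [t₀,∞) with φ(t) → 0 as t → +∞, one has lim_{t→+∞} ∫_{t₀}^{t} exp(−∫_{τ}^{t} g(s) ds) |h(τ)| φ(τ) dτ = 0. -/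
open Set Filter

/-- If `E → 0`, `w ≥ 0` and `E t * ∫ w` over `[a, t]` is bounded above, then integrating a
function tending to zero against the weight `w` gives a quantity whose product with `E` tends to
zero. -/
theorem tendsto_mul_integral_zero_of_bounded {a M : ℝ} {E w φ : ℝ → ℝ}
    (hE : Tendsto E atTop (nhds 0)) (hE0 : ∀ t, 0 ≤ E t)
    (hw : ContinuousOn w (Ici a)) (hw0 : ∀ t, 0 ≤ w t)
    (hM : ∀ t ∈ Ici a, E t * ∫ τ in a..t, w τ ≤ M)
    (hφ : ContinuousOn φ (Ici a)) (hφ0 : Tendsto φ atTop (nhds 0)) :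
    Tendsto (fun t => E t * ∫ τ in a..t, w τ * φ τ) atTop (nhds 0) := by
  have int_of_cont : ∀ {f : ℝ → ℝ}, ContinuousOn f (Ici a) → ∀ {x y : ℝ}, a ≤ x → a ≤ y →
      IntervalIntegrable f MeasureTheory.volume x y := fun hf x y hx hy =>
    (hf.mono fun z hz => (le_min hx hy).trans hz.1).intervalIntegrable
  have hM0 : 0 ≤ M := by simpa using hM a self_mem_Ici
  rw [Metric.tendsto_atTop]
  intro ε hε
  set δ := ε / (2 * (M + 1)) with hδ
  have hδ0 : 0 < δ := by positivity
  have hδM : δ * M < ε / 2 := by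
    rw [hδ, div_mul_eq_mul_div, div_lt_div_iff₀ (by positivity) (by positivity)]
    nlinarith
  obtain ⟨b₀, hb₀⟩ := Metric.tendsto_atTop.1 hφ0 δ hδ0
  set b := max a b₀
  have hab : a ≤ b := le_max_left _ _
  have head : Tendsto (fun t => E t * ∫ τ in a..b, w τ * φ τ) atTop (nhds 0) := by
    simpa using hE.mul_const (∫ τ in a..b, w τ * φ τ)
  obtain ⟨c, hc⟩ := Metric.tendsto_atTop.1 head (ε / 2) (half_pos hε)
  refine ⟨max b c, fun t ht => ?_⟩
  have hbt : b ≤ t := (le_max_left _ _).trans ht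
  have hat : a ≤ t := hab.trans hbt
  have hhead := hc t ((le_max_right _ _).trans ht)
  have htail : |∫ τ in b..t, w τ * φ τ| ≤ δ * ∫ τ in b..t, w τ := by
    rw [← intervalIntegral.integral_const_mul, ← Real.norm_eq_abs]
    refine intervalIntegral.norm_integral_le_of_norm_le hbt (.of_forall fun τ hτ => ?_)
      ((int_of_cont hw hab hat).const_mul δ)
    have hφτ := hb₀ τ ((le_max_right _ _).trans hτ.1.le)
    rw [dist_zero_right] at hφτ
    rw [norm_mul, Real.norm_of_nonneg (hw0 τ), mul_comm]
    exact mul_le_mul_of_nonneg_right hφτ.le (hw0 τ)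
  have hmono : ∫ τ in b..t, w τ ≤ ∫ τ in a..t, w τ := by
    rw [← intervalIntegral.integral_add_adjacent_intervals (int_of_cont hw le_rfl hab)
      (int_of_cont hw hab hat)]
    linarith [intervalIntegral.integral_nonneg (μ := MeasureTheory.volume) hab
      fun τ _ => hw0 τ]
  have hsmall : |E t * ∫ τ in b..t, w τ * φ τ| ≤ δ * M := by
    rw [abs_mul, abs_of_nonneg (hE0 t)]
    calc E t * |∫ τ in b..t, w τ * φ τ| ≤ E t * (δ * ∫ τ in a..t, w τ) :=
          mul_le_mul_of_nonneg_left (htail.trans (mul_le_mul_of_nonneg_left hmono hδ0.le)) (hE0 t)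
      _ = δ * (E t * ∫ τ in a..t, w τ) := by ring
      _ ≤ δ * M := mul_le_mul_of_nonneg_left (hM t hat) hδ0.le
  rw [dist_zero_right, Real.norm_eq_abs] at hhead ⊢
  have hwφ : ContinuousOn (fun τ => w τ * φ τ) (Ici a) := hw.mul hφ
  rw [← intervalIntegral.integral_add_adjacent_intervals
    (int_of_cont hwφ le_rfl hab) (int_of_cont hwφ hab hat), mul_add]
  linarith [abs_add_le (E t * ∫ τ in a..b, w τ * φ τ) (E t * ∫ τ in b..t, w τ * φ τ)]

/-- **Lemma 2.2**. Suppose `∫_{t₀}^t g → +∞` and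
`t ↦ ∫_{t₀}^t exp(−∫_τ^t g) |h(τ)| dτ` is bounded on `[t₀,∞)`. Then for every
continuous `φ` with `φ(t) → 0` as `t → +∞`,
`∫_{t₀}^t exp(−∫_τ^t g) |h(τ)| φ(τ) dτ → 0` as `t → +∞`. -/
theorem weighted_integral_tendsto_zero
    (t₀ : ℝ) (g h : ℝ → ℝ)
    (hg : ContinuousOn g (Ici t₀)) (hh : ContinuousOn h (Ici t₀))
    (hgdiv : Tendsto (fun t => ∫ τ in t₀..t, g τ) atTop atTop)
    (hbdd : ∃ M : ℝ, ∀ t ∈ Ici t₀,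
      (∫ τ in t₀..t, Real.exp (-∫ s in τ..t, g s) * |h τ|) ≤ M) :
    ∀ φ : ℝ → ℝ, ContinuousOn φ (Ici t₀) → Tendsto φ atTop (nhds 0) →
      Tendsto (fun t => ∫ τ in t₀..t, Real.exp (-∫ s in τ..t, g s) * |h τ| * φ τ)
        atTop (nhds 0) := by
  intro φ hφ hφ0
  obtain ⟨M, hM⟩ := hbdd
  have hg_int : ∀ {x y : ℝ}, t₀ ≤ x → t₀ ≤ y →
      IntervalIntegrable g MeasureTheory.volume x y := fun hx hy =>
    (hg.mono fun z hz => (le_min hx hy).trans hz.1).intervalIntegrable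
  set G : ℝ → ℝ := fun t => ∫ s in t₀..t, g s
  have hG : ContinuousOn G (Ici t₀) := by
    have hext : Continuous fun s => g (max t₀ s) :=
      hg.comp_continuous (by fun_prop) fun s => mem_Ici.2 (le_max_left _ _)
    refine (intervalIntegral.continuous_primitive (μ := MeasureTheory.volume)
      (fun x y => hext.intervalIntegrable x y) t₀).continuousOn.congr fun t ht => ?_
    refine intervalIntegral.integral_congr fun s hs => ?_
    rw [uIcc_of_le ht] at hs
    simp only [max_eq_right hs.1]
  have hker : ∀ {t : ℝ}, t₀ ≤ t → ∀ τ ∈ uIcc t₀ t,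
      Real.exp (-∫ s in τ..t, g s) = Real.exp (-G t) * Real.exp (G τ) := by
    intro t ht τ hτ
    rw [uIcc_of_le ht] at hτ
    rw [← Real.exp_add, ← intervalIntegral.integral_interval_sub_left
      (hg_int le_rfl ht) (hg_int le_rfl hτ.1)]
    congr 1
    ring
  have key := tendsto_mul_integral_zero_of_bounded (a := t₀) (M := M)
    (E := fun t => Real.exp (-G t)) (w := fun τ => Real.exp (G τ) * |h τ|)
    (Real.tendsto_exp_neg_atTop_nhds_zero.comp hgdiv) (fun t => (Real.exp_pos _).le)
    (hG.rexp.mul hh.abs) (fun t => by positivity) (fun t ht => ?_) hφ hφ0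
  · refine key.congr' ?_
    filter_upwards [eventually_ge_atTop t₀] with t ht
    rw [← intervalIntegral.integral_const_mul]
    refine intervalIntegral.integral_congr fun τ hτ => ?_
    simp only [hker ht τ hτ, mul_assoc]
  · refine le_of_eq_of_le ?_ (hM t ht)
    rw [← intervalIntegral.integral_const_mul]
    refine intervalIntegral.integral_congr fun τ hτ => ?_
    simp only [hker ht τ hτ, mul_assoc]
end

section
/- Consider the quaternionic linear system (1.1): Φ' = A(t)Φ + B(t)Ψ, Ψ' = C(t)Φ + D(t)Ψ on [t₀,∞), and the scalar comparison system (2.6): φ' = 𝔞*(t)φ + ‖B(t)‖ψ, ψ' = ‖C(t)‖φ + 𝔡*(t)ψ on [t₀,∞). Assume hypotheses (a) and (b) hold. If every solution (φ, ψ) of the scalar system (2.6) is bounded on [t₀,∞), then every solution (Φ, Ψ) of the system (1.1) is bounded on [t₀,∞). -/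
open scoped Quaternion
open Set Filter Matrix

/-- The Euclidean norm `‖q‖ = √(|q₁|² + ⋯ + |qₙ|²)` on `ℍⁿ`. -/
noncomputable def euclNorm {n : ℕ} (q : Fin n → ℍ[ℝ]) : ℝ :=
  Real.sqrt (∑ i, ‖q i‖ ^ 2)

/-- The operator norm `‖M‖ = sup_{q ≠ 0} ‖M q‖ / ‖q‖` of a quaternionic matrix,
with respect to the Euclidean norms. -/
noncomputable def qOpNorm {m n : ℕ} (M : Matrix (Fin m) (Fin n) ℍ[ℝ]) : ℝ :=
  sSup {r : ℝ | ∃ q : Fin n → ℍ[ℝ], q ≠ 0 ∧ r = euclNorm (M.mulVec q) / euclNorm q}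

/-- The entrywise integral `∫_τ^t A(s) ds` of a quaternionic matrix function. -/
noncomputable def matInt {k : ℕ} (A : ℝ → Matrix (Fin k) (Fin k) ℍ[ℝ]) (τ t : ℝ) :
    Matrix (Fin k) (Fin k) ℍ[ℝ] :=
  Matrix.of fun i j => ∫ s in τ..t, A s i j

open scoped Topology

/-- The real-linear operator `q ↦ M q` between Euclidean spaces, as a linear function of `M`. -/
noncomputable def mulVecCLM (m n : ℕ) : Matrix (Fin m) (Fin n) ℍ[ℝ] →ₗ[ℝ]
    (PiLp 2 fun _ : Fin n => ℍ[ℝ]) →L[ℝ] (PiLp 2 fun _ : Fin m => ℍ[ℝ]) where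
  toFun M := LinearMap.toContinuousLinearMap
    { toFun := fun q => WithLp.toLp 2 (M.mulVec q.ofLp)
      map_add' := fun x y => by simp [Matrix.mulVec_add]
      map_smul' := fun r x => by simp [Matrix.mulVec_smul] }
  map_add' M N := by ext1 q; exact congrArg (WithLp.toLp 2) (Matrix.add_mulVec M N q.ofLp)
  map_smul' r M := by ext1 q; exact congrArg (WithLp.toLp 2) (Matrix.smul_mulVec r M q.ofLp)

theorem mulVecCLM_toLp {m n : ℕ} (M : Matrix (Fin m) (Fin n) ℍ[ℝ]) (q : Fin n → ℍ[ℝ]) :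
    mulVecCLM m n M (WithLp.toLp 2 q) = WithLp.toLp 2 (M.mulVec q) := rfl

theorem euclNorm_eq_norm_toLp {n : ℕ} (q : Fin n → ℍ[ℝ]) :
    euclNorm q = ‖WithLp.toLp 2 q‖ := by
  rw [euclNorm, PiLp.norm_eq_of_L2]

theorem qOpNorm_eq_norm_mulVecCLM {m n : ℕ} (M : Matrix (Fin m) (Fin n) ℍ[ℝ]) :
    qOpNorm M = ‖mulVecCLM m n M‖ := by
  have hle : ∀ r ∈ {r : ℝ | ∃ q : Fin n → ℍ[ℝ], q ≠ 0 ∧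
      r = euclNorm (M.mulVec q) / euclNorm q}, r ≤ ‖mulVecCLM m n M‖ := by
    rintro r ⟨q, -, rfl⟩
    rw [euclNorm_eq_norm_toLp, euclNorm_eq_norm_toLp, ← mulVecCLM_toLp]
    exact ContinuousLinearMap.ratio_le_opNorm _ _
  have hnonneg : 0 ≤ qOpNorm M := by
    refine Real.sSup_nonneg ?_
    rintro r ⟨q, -, rfl⟩
    exact div_nonneg (Real.sqrt_nonneg _) (Real.sqrt_nonneg _)
  refine le_antisymm (Real.sSup_le hle (ContinuousLinearMap.opNorm_nonneg _)) ?_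
  refine ContinuousLinearMap.opNorm_le_bound _ hnonneg fun x => ?_
  obtain ⟨q, rfl⟩ := (WithLp.toLp_surjective 2) x
  rcases eq_or_ne q 0 with rfl | hq
  · simp
  have hpos : 0 < ‖WithLp.toLp 2 q‖ := norm_pos_iff.2 (by simpa using hq)
  rw [← div_le_iff₀ hpos]
  refine le_csSup ⟨_, hle⟩ ⟨q, hq, ?_⟩
  rw [euclNorm_eq_norm_toLp, euclNorm_eq_norm_toLp, mulVecCLM_toLp]

theorem qOpNorm_nonneg {m n : ℕ} (M : Matrix (Fin m) (Fin n) ℍ[ℝ]) : 0 ≤ qOpNorm M := by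
  rw [qOpNorm_eq_norm_mulVecCLM]
  exact ContinuousLinearMap.opNorm_nonneg _

theorem norm_toLp_mulVec_le {m n : ℕ} (M : Matrix (Fin m) (Fin n) ℍ[ℝ]) (q : Fin n → ℍ[ℝ]) :
    ‖WithLp.toLp 2 (M.mulVec q)‖ ≤ qOpNorm M * ‖WithLp.toLp 2 q‖ := by
  rw [qOpNorm_eq_norm_mulVecCLM, ← mulVecCLM_toLp]
  exact ContinuousLinearMap.le_opNorm _ _

theorem continuousOn_qOpNorm {m n : ℕ} {M : ℝ → Matrix (Fin m) (Fin n) ℍ[ℝ]} {s : Set ℝ}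
    (hM : ∀ i j, ContinuousOn (fun t => M t i j) s) :
    ContinuousOn (fun t => qOpNorm (M t)) s := by
  have h : ContinuousOn M s :=
    continuousOn_pi.2 fun i => continuousOn_pi.2 fun j => hM i j
  have hnorm : Continuous fun N : Matrix (Fin m) (Fin n) ℍ[ℝ] => ‖mulVecCLM m n N‖ :=
    Continuous.norm (f := fun N => mulVecCLM m n N)
      (mulVecCLM m n).continuous_of_finiteDimensional
  simp only [qOpNorm_eq_norm_mulVecCLM]
  exact hnorm.comp_continuousOn h

theorem inner_toLp_eq_re_dotProduct {n : ℕ} (x y : Fin n → ℍ[ℝ]) :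
    inner ℝ (WithLp.toLp 2 x) (WithLp.toLp 2 y) = (star x ⬝ᵥ y).re := by
  rw [PiLp.inner_apply, dotProduct]
  have hre : (∑ i, star x i * y i).re = ∑ i, (star x i * y i).re :=
    map_sum (⟨⟨fun q : ℍ[ℝ] => q.re, rfl⟩, fun _ _ => rfl⟩ : ℍ[ℝ] →+ ℝ) _ _
  rw [hre]
  refine Finset.sum_congr rfl fun i _ => ?_
  simp [Quaternion.inner_def]

theorem inner_toLp_mulVec {m n : ℕ} (M : Matrix (Fin m) (Fin n) ℍ[ℝ]) (x : Fin m → ℍ[ℝ])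
    (y : Fin n → ℍ[ℝ]) :
    inner ℝ (WithLp.toLp 2 x) (WithLp.toLp 2 (M.mulVec y)) =
      inner ℝ (WithLp.toLp 2 (Mᴴ.mulVec x)) (WithLp.toLp 2 y) := by
  simp only [inner_toLp_eq_re_dotProduct, Matrix.star_mulVec, Matrix.dotProduct_mulVec,
    Matrix.conjTranspose_conjTranspose]

theorem inner_mulVec_le_of_unitarily_diagonal {n : ℕ} {M U : Matrix (Fin n) (Fin n) ℍ[ℝ]}
    {a : Fin n → ℍ[ℝ]} {c : ℝ} (hU : U * Uᴴ = 1) (hM : M = U * Matrix.diagonal a * Uᴴ)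
    (ha : ∀ l, (a l).re ≤ c) (x : Fin n → ℍ[ℝ]) :
    inner ℝ (WithLp.toLp 2 x) (WithLp.toLp 2 (M.mulVec x)) ≤ c * ‖WithLp.toLp 2 x‖ ^ 2 := by
  set y := Uᴴ.mulVec x with hy
  have hnorm : ‖WithLp.toLp 2 x‖ ^ 2 = ∑ i, ‖y i‖ ^ 2 := by
    have h : x = U.mulVec y := by rw [hy, Matrix.mulVec_mulVec, hU, Matrix.one_mulVec]
    rw [← real_inner_self_eq_norm_sq]
    nth_rewrite 2 [h]
    rw [inner_toLp_mulVec, ← hy, real_inner_self_eq_norm_sq, PiLp.norm_sq_eq_of_L2]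
  have hquad : ∀ q p : ℍ[ℝ], inner ℝ q (p * q) = p.re * ‖q‖ ^ 2 := by
    intro q p
    rw [Quaternion.inner_def, sq, ← Quaternion.normSq_eq_norm_mul_self, Quaternion.normSq_def']
    simp
    ring
  rw [hM, ← Matrix.mulVec_mulVec, ← Matrix.mulVec_mulVec, inner_toLp_mulVec, ← hy,
    PiLp.inner_apply, hnorm, Finset.mul_sum]
  refine Finset.sum_le_sum fun i _ => ?_
  simp only [Matrix.mulVec_diagonal, hquad]
  exact mul_le_mul_of_nonneg_right (ha i) (by positivity)

theorem HasDerivAt.nonneg_of_forall_ge {g : ℝ → ℝ} {g' t : ℝ} (hg : HasDerivAt g g' t)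
    (h : ∀ s, t ≤ s → g t ≤ g s) : 0 ≤ g' := by
  have hs := hasDerivWithinAt_iff_tendsto_slope' self_notMem_Ioi |>.1
    (hg.hasDerivWithinAt (s := Ioi t))
  refine ge_of_tendsto hs (eventually_mem_nhdsWithin.mono fun s hts => ?_)
  rw [slope_def_field]
  exact div_nonneg (sub_nonneg.2 (h s (le_of_lt hts))) (sub_nonneg.2 (le_of_lt hts))

theorem continuous_comp_max_of_continuousOn_Ici {X : Type*} [TopologicalSpace X] {f : ℝ → X}
    {t₀ : ℝ} (hf : ContinuousOn f (Ici t₀)) : Continuous fun t => f (max t t₀) :=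
  hf.comp_continuous (continuous_id.max continuous_const) fun t => le_max_right t t₀

theorem inner_mulVec_le_of_matInt {n : ℕ} {A : ℝ → Matrix (Fin n) (Fin n) ℍ[ℝ]} {α : ℝ → ℝ}
    {t₀ : ℝ} (hA : ∀ i j, ContinuousOn (fun t => A t i j) (Ici t₀))
    (hα : ContinuousOn α (Ici t₀))
    (hdiag : ∀ τ t, t₀ ≤ τ → τ ≤ t →
      ∃ (U : Matrix (Fin n) (Fin n) ℍ[ℝ]) (a : Fin n → ℍ[ℝ]),
        U * Uᴴ = 1 ∧ Uᴴ * U = 1 ∧ matInt A τ t = U * Matrix.diagonal a * Uᴴ ∧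
        ∀ l, (a l).re ≤ ∫ s in τ..t, α s)
    {τ : ℝ} (hτ : t₀ ≤ τ) (x : Fin n → ℍ[ℝ]) :
    inner ℝ (WithLp.toLp 2 x) (WithLp.toLp 2 ((A τ).mulVec x)) ≤
      α τ * ‖WithLp.toLp 2 x‖ ^ 2 := by
  have hcongr : ∀ {X : Type} [NormedAddCommGroup X] [NormedSpace ℝ X] (f : ℝ → X) (t : ℝ),
      τ ≤ t → ∫ s in τ..t, f s = ∫ s in τ..t, f (max s t₀) := by
    intro X _ _ f t ht
    refine intervalIntegral.integral_congr fun s hs => ?_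
    rw [uIcc_of_le ht] at hs
    simp only [max_eq_left (hτ.trans hs.1)]
  have hderiv : ∀ {X : Type} [NormedAddCommGroup X] [NormedSpace ℝ X] [CompleteSpace X]
      (f : ℝ → X), ContinuousOn f (Ici t₀) →
      HasDerivAt (fun t => ∫ s in τ..t, f (max s t₀)) (f τ) τ := by
    intro X _ _ _ f hf
    have hc := continuous_comp_max_of_continuousOn_Ici hf
    have := intervalIntegral.integral_hasDerivAt_right (hc.intervalIntegrable τ τ)
      hc.stronglyMeasurable.stronglyMeasurableAtFilter hc.continuousAt
    simpa only [max_eq_left hτ] using this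
  have hentry : HasDerivAt (fun t => ∑ i, inner ℝ (x i)
      (∑ j, (∫ s in τ..t, A (max s t₀) i j) * x j))
      (∑ i, inner ℝ (x i) (∑ j, A τ i j * x j)) τ := by
    refine HasDerivAt.fun_sum fun i _ => ?_
    have h : HasDerivAt (fun t => ∑ j, (∫ s in τ..t, A (max s t₀) i j) * x j)
        (∑ j, A τ i j * x j) τ :=
      HasDerivAt.fun_sum fun j _ => (hderiv _ (hA i j)).mul_const (x j)
    simpa using (hasDerivAt_const τ (x i)).inner ℝ h
  have hg := ((hderiv α hα).mul_const (‖WithLp.toLp 2 x‖ ^ 2)).fun_sub hentry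
  have hnonneg := hg.nonneg_of_forall_ge fun t ht => by
    obtain ⟨U, a, hU, -, hM, ha⟩ := hdiag τ t hτ ht
    have hle := inner_mulVec_le_of_unitarily_diagonal hU hM ha x
    simp only [intervalIntegral.integral_same, zero_mul, Finset.sum_const_zero, inner_zero_right,
      sub_zero, sub_nonneg]
    rw [hcongr α t ht] at hle
    refine le_trans (le_of_eq ?_) hle
    rw [PiLp.inner_apply]
    refine Finset.sum_congr rfl fun i _ => ?_
    congr 1
    refine Finset.sum_congr rfl fun j _ => ?_
    rw [← hcongr (fun s => A s i j) t ht]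
    rfl
  rw [PiLp.inner_apply]
  exact sub_nonneg.1 hnonneg

theorem norm_integral_exp_smul_le {E : Type*} [NormedAddCommGroup E] [NormedSpace ℝ E]
    {k : ℝ → ℝ} (hk : Continuous k) {t₀ t C : ℝ} (ht : t₀ ≤ t) (hC : 0 ≤ C) {f : ℝ → E}
    (hf : ∀ s, ‖f s‖ ≤ k s * C) :
    ‖∫ s in t₀..t, Real.exp (2 * ∫ r in t₀..s, k r) • f s‖ ≤
      Real.exp (2 * ∫ r in t₀..t, k r) * (C / 2) := by
  have hd : ∀ s, HasDerivAt (fun s => Real.exp (2 * ∫ r in t₀..s, k r) * (C / 2))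
      (Real.exp (2 * ∫ r in t₀..s, k r) * (k s * C)) s := fun s => by
    have h := (((hk.integral_hasStrictDerivAt t₀ s).hasDerivAt.const_mul 2).exp).mul_const (C / 2)
    exact h.congr_deriv (by ring)
  have hprim : Continuous fun s => ∫ r in t₀..s, k r :=
    intervalIntegral.continuous_primitive (fun a b => hk.intervalIntegrable a b) t₀
  have hcont : Continuous fun s => Real.exp (2 * ∫ r in t₀..s, k r) * (k s * C) := by fun_prop
  have hint : ∫ s in t₀..t, Real.exp (2 * ∫ r in t₀..s, k r) * (k s * C) = _ :=
    intervalIntegral.integral_eq_sub_of_hasDerivAt (fun s _ => hd s)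
      (hcont.intervalIntegrable t₀ t)
  refine (intervalIntegral.norm_integral_le_of_norm_le ht (Eventually.of_forall fun s _ => ?_)
    (hcont.intervalIntegrable t₀ t)).trans ?_
  · rw [norm_smul, Real.norm_of_nonneg (Real.exp_pos _).le]
    exact mul_le_mul_of_nonneg_left (hf s) (Real.exp_pos _).le
  · rw [hint]
    simp only [intervalIntegral.integral_same, mul_zero, Real.exp_zero, one_mul]
    linarith

/-- Global forward solvability of linear differential equations, by contraction of the Picard
operator in an exponentially weighted supremum norm. -/
theorem exists_hasDerivAt_linear {E : Type*} [NormedAddCommGroup E] [NormedSpace ℝ E]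
    [CompleteSpace E] {M : ℝ → E →L[ℝ] E} (hM : Continuous M) (t₀ : ℝ) (x₀ : E) :
    ∃ x : ℝ → E, x t₀ = x₀ ∧ ∀ t, t₀ ≤ t → HasDerivAt x (M t (x t)) t := by
  set k : ℝ → ℝ := fun t => ‖M t‖ with hk_def
  have hk : Continuous k := hM.norm
  set L : ℝ → ℝ := fun t => 2 * ∫ r in t₀..t, k r with hL_def
  have hL : Continuous L := continuous_const.mul
    (intervalIntegral.continuous_primitive (fun a b => hk.intervalIntegrable a b) t₀)
  have hL₀ : ∀ t, t₀ ≤ t → 0 ≤ L t := fun t ht => mul_nonneg zero_le_two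
    (intervalIntegral.integral_nonneg ht fun _ _ => norm_nonneg _)
  have hint : ∀ w : BoundedContinuousFunction ℝ E,
      Continuous fun s => Real.exp (L s) • M s (w s) := fun w =>
    (Real.continuous_exp.comp hL).smul (hM.clm_apply w.continuous)
  set P : BoundedContinuousFunction ℝ E → ℝ → E := fun w t =>
    x₀ + ∫ s in t₀..t, Real.exp (L s) • M s (w s) with hP_def
  have hP : ∀ w, Continuous (P w) := fun w => continuous_const.add
    (intervalIntegral.continuous_primitive (fun a b => (hint w).intervalIntegrable a b) t₀)
  have hPd : ∀ w t, HasDerivAt (P w) (Real.exp (L t) • M t (w t)) t := fun w t =>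
    ((hint w).integral_hasStrictDerivAt t₀ t).hasDerivAt.const_add x₀
  have hbound : ∀ (w : BoundedContinuousFunction ℝ E) (t : ℝ), t₀ ≤ t →
      ‖∫ s in t₀..t, Real.exp (L s) • M s (w s)‖ ≤ Real.exp (L t) * (‖w‖ / 2) := fun w t ht =>
    norm_integral_exp_smul_le hk ht (norm_nonneg w) fun s =>
      (M s).le_opNorm_of_le (w.norm_coe_le_norm s)
  have hweight : ∀ t (y : E) (C : ℝ), ‖y‖ ≤ Real.exp (L t) * C → ‖Real.exp (-L t) • y‖ ≤ C := by
    intro t y C hy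
    rw [norm_smul, Real.norm_of_nonneg (Real.exp_pos _).le, Real.exp_neg, inv_mul_le_iff₀
      (Real.exp_pos _)]
    exact hy
  set T : BoundedContinuousFunction ℝ E → BoundedContinuousFunction ℝ E := fun w =>
    BoundedContinuousFunction.ofNormedAddCommGroup
      (fun t => Real.exp (-L (max t t₀)) • P w (max t t₀))
      (by have := hP w; fun_prop) (‖x₀‖ + ‖w‖ / 2) (fun t => by
        have ht := le_max_right t t₀
        refine hweight _ _ _ ((norm_add_le _ _).trans ?_)
        rw [mul_add]
        exact add_le_add (le_mul_of_one_le_left (norm_nonneg _) (Real.one_le_exp (hL₀ _ ht)))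
          (hbound w _ ht)) with hT_def
  have hT : ContractingWith (1 / 2) T := by
    refine ⟨NNReal.half_lt_self one_ne_zero, LipschitzWith.of_dist_le_mul fun v w => ?_⟩
    rw [dist_eq_norm, dist_eq_norm]
    refine (BoundedContinuousFunction.norm_le (by positivity)).2 fun t => ?_
    have hsub : (T v - T w) t = Real.exp (-L (max t t₀)) •
        ∫ s in t₀..max t t₀, Real.exp (L s) • M s ((v - w) s) := by
      simp only [hT_def, hP_def, BoundedContinuousFunction.coe_sub, Pi.sub_apply,
        BoundedContinuousFunction.coe_ofNormedAddCommGroup, map_sub, smul_sub]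
      rw [intervalIntegral.integral_sub ((hint v).intervalIntegrable _ _)
        ((hint w).intervalIntegrable _ _), ← smul_sub, add_sub_add_left_eq_sub, smul_sub]
    rw [hsub]
    refine hweight _ _ _ ((hbound (v - w) _ (le_max_right t t₀)).trans (le_of_eq ?_))
    push_cast
    ring
  obtain ⟨w, hw⟩ : ∃ w, T w = w := ⟨_, hT.fixedPoint_isFixedPt⟩
  refine ⟨P w, by simp [hP_def], fun t ht => ?_⟩
  have hwt : Real.exp (L t) • w t = P w t := by
    have h : w t = Real.exp (-L (max t t₀)) • P w (max t t₀) :=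
      (DFunLike.congr_fun hw t).symm
    rw [h, max_eq_left ht, smul_smul, ← Real.exp_add, add_neg_cancel, Real.exp_zero, one_smul]
  rw [← hwt, map_smul]
  exact hPd w t

theorem HasDerivAt.eventually_right_pos {g : ℝ → ℝ} {g' t : ℝ} (hg : HasDerivAt g g' t)
    (h₀ : 0 ≤ g t) (h : 0 < g') : ∀ᶠ s in 𝓝[>] t, 0 < g s := by
  have hs := hasDerivWithinAt_iff_tendsto_slope' self_notMem_Ioi |>.1
    (hg.hasDerivWithinAt (s := Ioi t))
  filter_upwards [hs.eventually (lt_mem_nhds h), self_mem_nhdsWithin] with s hslope hts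
  rw [slope_def_field, div_pos_iff_of_pos_right (sub_pos.2 hts)] at hslope
  linarith

theorem eventually_right_norm_le {E : Type*} [NormedAddCommGroup E] [InnerProductSpace ℝ E]
    {f : ℝ → E} {f' : E} {z : ℝ → ℝ} {z' r t : ℝ} (hf : HasDerivAt f f' t)
    (hz : HasDerivAt z z' t) (hle : ‖f t‖ ≤ z t)
    (hinner : inner ℝ (f t) f' ≤ r * ‖f t‖) (hzero : f t = 0 → ‖f'‖ ≤ r)
    (hr : ‖f t‖ = z t → r < z') : ∀ᶠ s in 𝓝[>] t, ‖f s‖ ≤ z s := by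
  rcases hle.lt_or_eq with hlt | heq
  · exact ((hf.continuousAt.norm.eventually_lt hz.continuousAt hlt).filter_mono
      nhdsWithin_le_nhds).mono fun s hs => hs.le
  have hrz := hr heq
  rcases eq_or_ne (f t) 0 with h₀ | h₀
  · obtain ⟨q, hq, hqz⟩ := exists_between hrz
    have hzt : z t = 0 := by rw [← heq, h₀, norm_zero]
    have hpos := (hz.fun_sub (((hasDerivAt_id t).sub_const t).const_mul q)).eventually_right_pos
      (by simp [hzt]) (by linarith)
    filter_upwards [(hf.hasDerivWithinAt (s := Ioi t)).limsup_norm_slope_le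
      ((hzero h₀).trans_lt hq), hpos, self_mem_nhdsWithin] with s hs hs' hts
    have hst : 0 < s - t := sub_pos.2 hts
    rw [h₀, sub_zero, Real.norm_of_nonneg hst.le, inv_mul_lt_iff₀ hst] at hs
    simp only [id] at hs'
    linarith
  · have hpos : 0 < ‖f t‖ := norm_pos_iff.2 h₀
    have hsq := ((hz.fun_pow 2).fun_sub hf.norm_sq).eventually_right_pos (by simp [heq])
      (by
        have h := mul_lt_mul_of_pos_right hrz hpos
        rw [heq] at h hinner
        simp
        linarith)
    filter_upwards [hsq, (hz.continuousAt.eventually (lt_mem_nhds (heq ▸ hpos))).filter_mono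
      nhdsWithin_le_nhds] with s hs hzs
    exact abs_le_of_sq_le_sq' (by linarith) hzs.le |>.2

/-- Comparison of a pair of curves with a cooperative planar linear system. -/
theorem norm_le_of_cooperative_system {E F : Type*} [NormedAddCommGroup E]
    [InnerProductSpace ℝ E] [NormedAddCommGroup F] [InnerProductSpace ℝ F] {t₀ : ℝ}
    {a b c d φ ψ : ℝ → ℝ} {f f' : ℝ → E} {g g' : ℝ → F}
    (ha : ContinuousOn a (Ici t₀)) (hb : ContinuousOn b (Ici t₀))
    (hc : ContinuousOn c (Ici t₀)) (hd : ContinuousOn d (Ici t₀))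
    (hb₀ : ∀ t, 0 ≤ b t) (hc₀ : ∀ t, 0 ≤ c t)
    (hf : ∀ t, t₀ ≤ t → HasDerivAt f (f' t) t) (hg : ∀ t, t₀ ≤ t → HasDerivAt g (g' t) t)
    (hf_inner : ∀ t, t₀ ≤ t → inner ℝ (f t) (f' t) ≤ (a t * ‖f t‖ + b t * ‖g t‖) * ‖f t‖)
    (hf_zero : ∀ t, t₀ ≤ t → f t = 0 → ‖f' t‖ ≤ b t * ‖g t‖)
    (hg_inner : ∀ t, t₀ ≤ t → inner ℝ (g t) (g' t) ≤ (c t * ‖f t‖ + d t * ‖g t‖) * ‖g t‖)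
    (hg_zero : ∀ t, t₀ ≤ t → g t = 0 → ‖g' t‖ ≤ c t * ‖f t‖)
    (hφ : ∀ t, t₀ ≤ t → HasDerivAt φ (a t * φ t + b t * ψ t) t)
    (hψ : ∀ t, t₀ ≤ t → HasDerivAt ψ (c t * φ t + d t * ψ t) t)
    (hφ₀ : ‖f t₀‖ ≤ φ t₀) (hψ₀ : ‖g t₀‖ ≤ ψ t₀) {T : ℝ} (hT : t₀ ≤ T) :
    ‖f T‖ ≤ φ T ∧ ‖g T‖ ≤ ψ T := by
  obtain ⟨K₁, hK₁⟩ := (isCompact_Icc (a := t₀) (b := T)).bddAbove_image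
    ((ha.add hb).mono Icc_subset_Ici_self)
  obtain ⟨K₂, hK₂⟩ := (isCompact_Icc (a := t₀) (b := T)).bddAbove_image
    ((hc.add hd).mono Icc_subset_Ici_self)
  set K := max K₁ K₂ + 1 with hK_def
  have hab : ∀ t ∈ Icc t₀ T, a t + b t < K := fun t ht => by
    have h₁ := hK₁ (mem_image_of_mem _ ht)
    have h₂ := le_max_left K₁ K₂
    simp only [Pi.add_apply] at h₁
    linarith
  have hcd : ∀ t ∈ Icc t₀ T, c t + d t < K := fun t ht => by
    have h₁ := hK₂ (mem_image_of_mem _ ht)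
    have h₂ := le_max_right K₁ K₂
    simp only [Pi.add_apply] at h₁
    linarith
  suffices hδ : ∀ δ > 0, ‖f T‖ ≤ φ T + δ ∧ ‖g T‖ ≤ ψ T + δ from
    ⟨le_of_forall_pos_le_add fun δ h => (hδ δ h).1, le_of_forall_pos_le_add fun δ h => (hδ δ h).2⟩
  intro δ hδ
  set e : ℝ → ℝ := fun t => δ * Real.exp (K * (t - T)) with he_def
  have he : ∀ t, 0 < e t := fun t => by positivity
  have hed : ∀ t, HasDerivAt e (K * e t) t := fun t => by
    have h := ((((hasDerivAt_id t).sub_const T).const_mul K).exp).const_mul δ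
    exact h.congr_deriv (by simp only [he_def, id]; ring)
  set S : Set ℝ := {t | ‖f t‖ ≤ φ t + e t ∧ ‖g t‖ ≤ ψ t + e t} with hS_def
  have hclosed : IsClosed (S ∩ Icc t₀ T) := by
    have h₁ : ContinuousOn (fun t => ‖f t‖) (Icc t₀ T) := fun t ht =>
      (hf t ht.1).continuousAt.norm.continuousWithinAt
    have h₂ : ContinuousOn (fun t => ‖g t‖) (Icc t₀ T) := fun t ht =>
      (hg t ht.1).continuousAt.norm.continuousWithinAt
    have h₃ : ContinuousOn (fun t => φ t + e t) (Icc t₀ T) := fun t ht =>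
      ((hφ t ht.1).continuousAt.add (hed t).continuousAt).continuousWithinAt
    have h₄ : ContinuousOn (fun t => ψ t + e t) (Icc t₀ T) := fun t ht =>
      ((hψ t ht.1).continuousAt.add (hed t).continuousAt).continuousWithinAt
    convert (isClosed_Icc.isClosed_le h₁ h₃).inter (isClosed_Icc.isClosed_le h₂ h₄) using 1
    ext t
    simp only [hS_def, mem_inter_iff, mem_ofPred_eq]
    tauto
  have hsub : Icc t₀ T ⊆ S := by
    refine hclosed.Icc_subset_of_forall_mem_nhdsWithin
      ⟨by linarith [he t₀], by linarith [he t₀]⟩ ?_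
    rintro t ⟨⟨htf, htg⟩, ht⟩
    have htI : t ∈ Icc t₀ T := ⟨ht.1, ht.2.le⟩
    refine Filter.Eventually.and ?_ ?_
    · refine eventually_right_norm_le (hf t ht.1) ((hφ t ht.1).fun_add (hed t)) htf
        (hf_inner t ht.1) (fun h => ?_) (fun h => ?_)
      · simpa [h] using hf_zero t ht.1 h
      · have h₁ := mul_le_mul_of_nonneg_left htg (hb₀ t)
        have h₂ := mul_lt_mul_of_pos_right (hab t htI) (he t)
        rw [h]
        linarith
    · refine eventually_right_norm_le (hg t ht.1) ((hψ t ht.1).fun_add (hed t)) htg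
        (hg_inner t ht.1) (fun h => ?_) (fun h => ?_)
      · simpa [h] using hg_zero t ht.1 h
      · have h₁ := mul_le_mul_of_nonneg_left htf (hc₀ t)
        have h₂ := mul_lt_mul_of_pos_right (hcd t htI) (he t)
        rw [h]
        linarith
  simpa [hS_def, he_def] using hsub (right_mem_Icc.2 hT)

/-- Global forward solvability of planar linear systems with continuous coefficients. -/
theorem exists_hasDerivAt_planar_linear {a b c d : ℝ → ℝ} {t₀ : ℝ}
    (ha : ContinuousOn a (Ici t₀)) (hb : ContinuousOn b (Ici t₀))
    (hc : ContinuousOn c (Ici t₀)) (hd : ContinuousOn d (Ici t₀)) (u v : ℝ) :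
    ∃ φ ψ : ℝ → ℝ, φ t₀ = u ∧ ψ t₀ = v ∧ ∀ t, t₀ ≤ t →
      HasDerivAt φ (a t * φ t + b t * ψ t) t ∧ HasDerivAt ψ (c t * φ t + d t * ψ t) t := by
  have ha' := continuous_comp_max_of_continuousOn_Ici ha
  have hb' := continuous_comp_max_of_continuousOn_Ici hb
  have hc' := continuous_comp_max_of_continuousOn_Ici hc
  have hd' := continuous_comp_max_of_continuousOn_Ici hd
  set π₁ := ContinuousLinearMap.fst ℝ ℝ ℝ
  set π₂ := ContinuousLinearMap.snd ℝ ℝ ℝ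
  set ι₁ := ContinuousLinearMap.inl ℝ ℝ ℝ
  set ι₂ := ContinuousLinearMap.inr ℝ ℝ ℝ
  obtain ⟨x, hx₀, hx⟩ := exists_hasDerivAt_linear
    (M := fun t => a (max t t₀) • ι₁ ∘L π₁ + b (max t t₀) • ι₁ ∘L π₂ +
      c (max t t₀) • ι₂ ∘L π₁ + d (max t t₀) • ι₂ ∘L π₂)
    (((ha'.smul continuous_const).add (hb'.smul continuous_const)).add
        (hc'.smul continuous_const) |>.add
        (hd'.smul continuous_const)) t₀ (u, v)
  refine ⟨fun t => (x t).1, fun t => (x t).2, by simp [hx₀], by simp [hx₀], fun t ht => ?_⟩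
  have h := hx t ht
  rw [max_eq_left ht] at h
  exact ⟨(π₁.hasFDerivAt.comp_hasDerivAt t h).congr_deriv (by simp [π₁, π₂, ι₁, ι₂]),
    (π₂.hasFDerivAt.comp_hasDerivAt t h).congr_deriv (by simp [π₁, π₂, ι₁, ι₂])⟩

theorem inner_add_le_of_quadratic_bound {m n : ℕ} {A : Matrix (Fin m) (Fin m) ℍ[ℝ]} {α : ℝ}
    {x : Fin m → ℍ[ℝ]}
    (hA : inner ℝ (WithLp.toLp 2 x) (WithLp.toLp 2 (A.mulVec x)) ≤ α * ‖WithLp.toLp 2 x‖ ^ 2)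
    (B : Matrix (Fin m) (Fin n) ℍ[ℝ]) (y : Fin n → ℍ[ℝ]) :
    inner ℝ (WithLp.toLp 2 x) (WithLp.toLp 2 (A.mulVec x + B.mulVec y)) ≤
      (α * ‖WithLp.toLp 2 x‖ + qOpNorm B * ‖WithLp.toLp 2 y‖) * ‖WithLp.toLp 2 x‖ := by
  rw [WithLp.toLp_add, inner_add_right]
  have h := (real_inner_le_norm (WithLp.toLp 2 x) (WithLp.toLp 2 (B.mulVec y))).trans
    (mul_le_mul_of_nonneg_left (norm_toLp_mulVec_le B y) (norm_nonneg _))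
  linarith

theorem HasDerivAt.toLp_two {n : ℕ} {x : ℝ → Fin n → ℍ[ℝ]} {x' : Fin n → ℍ[ℝ]} {t : ℝ}
    (hx : HasDerivAt x x' t) :
    HasDerivAt (fun s => WithLp.toLp 2 (x s)) (WithLp.toLp 2 x') t :=
  (PiLp.hasFDerivAt_toLp 2 (𝕜 := ℝ) (x t)).comp_hasDerivAt t hx

/-- **Lemma 2.4, boundedness part**. Under hypotheses (a) and (b), Lyapunov
stability of the scalar comparison system (2.6) implies Lyapunov stability of
the quaternionic linear system (1.1). -/
theorem lyapunov_stable_of_scalar_comparison {m n : ℕ} (t₀ : ℝ)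
    (A : ℝ → Matrix (Fin m) (Fin m) ℍ[ℝ]) (B : ℝ → Matrix (Fin m) (Fin n) ℍ[ℝ])
    (C : ℝ → Matrix (Fin n) (Fin m) ℍ[ℝ]) (D : ℝ → Matrix (Fin n) (Fin n) ℍ[ℝ])
    (𝔞 𝔡 : ℝ → ℝ)
    (hA : ∀ i j, ContinuousOn (fun t => A t i j) (Ici t₀))
    (hB : ∀ i j, ContinuousOn (fun t => B t i j) (Ici t₀))
    (hC : ∀ i j, ContinuousOn (fun t => C t i j) (Ici t₀))
    (hD : ∀ i j, ContinuousOn (fun t => D t i j) (Ici t₀))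
    (h𝔞 : ContinuousOn 𝔞 (Ici t₀)) (h𝔡 : ContinuousOn 𝔡 (Ici t₀))
    -- hypothesis (a)
    (haA : ∀ t ∈ Ici t₀, ∀ τ ∈ Ici t₀, A t * matInt A t₀ τ = matInt A t₀ τ * A t)
    (haD : ∀ t ∈ Ici t₀, ∀ τ ∈ Ici t₀, D t * matInt D t₀ τ = matInt D t₀ τ * D t)
    -- hypothesis (b)
    (hbA : ∀ τ t, t₀ ≤ τ → τ ≤ t →
      ∃ (U : Matrix (Fin m) (Fin m) ℍ[ℝ]) (a : Fin m → ℍ[ℝ]),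
        U * Uᴴ = 1 ∧ Uᴴ * U = 1 ∧ matInt A τ t = U * Matrix.diagonal a * Uᴴ ∧
        ∀ l, (a l).re ≤ ∫ s in τ..t, 𝔞 s)
    (hbD : ∀ τ t, t₀ ≤ τ → τ ≤ t →
      ∃ (V : Matrix (Fin n) (Fin n) ℍ[ℝ]) (d : Fin n → ℍ[ℝ]),
        V * Vᴴ = 1 ∧ Vᴴ * V = 1 ∧ matInt D τ t = V * Matrix.diagonal d * Vᴴ ∧
        ∀ r, (d r).re ≤ ∫ s in τ..t, 𝔡 s)
    -- every solution of the scalar comparison system (2.6) is bounded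
    (hscalar : ∀ φ ψ : ℝ → ℝ,
      (∀ t ∈ Ici t₀,
        HasDerivAt φ (𝔞 t * φ t + qOpNorm (B t) * ψ t) t ∧
        HasDerivAt ψ (qOpNorm (C t) * φ t + 𝔡 t * ψ t) t) →
      ∃ M : ℝ, ∀ t ∈ Ici t₀, |φ t| ≤ M ∧ |ψ t| ≤ M) :
    -- then every solution of the system (1.1) is bounded
    ∀ (Φ : ℝ → Fin m → ℍ[ℝ]) (Ψ : ℝ → Fin n → ℍ[ℝ]),
      (∀ t ∈ Ici t₀,
        HasDerivAt Φ ((A t).mulVec (Φ t) + (B t).mulVec (Ψ t)) t ∧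
        HasDerivAt Ψ ((C t).mulVec (Φ t) + (D t).mulVec (Ψ t)) t) →
      ∃ M : ℝ, ∀ t ∈ Ici t₀, euclNorm (Φ t) ≤ M ∧ euclNorm (Ψ t) ≤ M := by
  intro Φ Ψ hsol
  have hnormB := continuousOn_qOpNorm hB
  have hnormC := continuousOn_qOpNorm hC
  obtain ⟨φ, ψ, hφ₀, hψ₀, hφψ⟩ := exists_hasDerivAt_planar_linear h𝔞 hnormB hnormC h𝔡
    ‖WithLp.toLp 2 (Φ t₀)‖ ‖WithLp.toLp 2 (Ψ t₀)‖
  obtain ⟨M, hM⟩ := hscalar φ ψ hφψ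
  refine ⟨M, fun T hT => ?_⟩
  have hcomp := norm_le_of_cooperative_system (f := fun t => WithLp.toLp 2 (Φ t))
    (g := fun t => WithLp.toLp 2 (Ψ t)) h𝔞 hnormB hnormC h𝔡
    (fun t => qOpNorm_nonneg (B t)) (fun t => qOpNorm_nonneg (C t))
    (fun t ht => (hsol t ht).1.toLp_two)
    (fun t ht => (hsol t ht).2.toLp_two)
    (fun t ht => inner_add_le_of_quadratic_bound
      (inner_mulVec_le_of_matInt hA h𝔞 hbA ht (Φ t)) (B t) (Ψ t))
    (fun t ht h => by
      rw [WithLp.toLp_eq_zero] at h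
      simpa [h] using norm_toLp_mulVec_le (B t) (Ψ t))
    (fun t ht => by
      have h := inner_add_le_of_quadratic_bound
        (inner_mulVec_le_of_matInt hD h𝔡 hbD ht (Ψ t)) (C t) (Φ t)
      rwa [add_comm (D t *ᵥ Ψ t), add_comm (𝔡 t * _)] at h)
    (fun t ht h => by
      rw [WithLp.toLp_eq_zero] at h
      simpa [h] using norm_toLp_mulVec_le (C t) (Φ t))
    (fun t ht => (hφψ t ht).1) (fun t ht => (hφψ t ht).2) hφ₀.ge hψ₀.ge hT
  rw [euclNorm_eq_norm_toLp, euclNorm_eq_norm_toLp]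
  exact ⟨hcomp.1.trans ((le_abs_self _).trans (hM T hT).1),
    hcomp.2.trans ((le_abs_self _).trans (hM T hT).2)⟩
end

section
/- Let b, c, E be continuous real-valued functions on [t₀,∞) with b(t) ≥ 0 and c(t) ≥ 0 for all t ≥ t₀. Then for every t₁ ≥ t₀ and every γ ≥ 0, the Riccati equation y' + b(t)y² + E(t)y − c(t) = 0 has a continuously differentiable solution y on all of [t₁,∞) with y(t₁) = γ and y(t) ≥ 0 for all t ≥ t₁. -/
open Set

section DysonSeries

variable {V : Type*} [NormedAddCommGroup V] [NormedSpace ℝ V]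

/-- The terms of the Dyson series of the linear equation `x' = A(t) x`, `x(a) = x₀`. -/
noncomputable def dysonTerm (A : ℝ → V →L[ℝ] V) (a : ℝ) (x₀ : V) : ℕ → ℝ → V
  | 0 => fun _ => x₀
  | n + 1 => fun t => ∫ s in a..t, A s (dysonTerm A a x₀ n s)

theorem norm_intervalIntegral_le_of_norm_le_pow {f : ℝ → V} (hf : Continuous f) {a C t : ℝ}
    {n : ℕ} (h : ∀ s ∈ uIcc a t, ‖f s‖ ≤ C * |s - a| ^ n) :
    ‖∫ s in a..t, f s‖ ≤ C * (|t - a| ^ (n + 1) / (n + 1)) := by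
  have hg : Continuous fun s : ℝ => C * |s - a| ^ n := by fun_prop
  calc ‖∫ s in a..t, f s‖ ≤ ∫ s in uIoc a t, ‖f s‖ :=
        intervalIntegral.norm_integral_le_integral_norm_uIoc
    _ ≤ ∫ s in uIoc a t, C * |s - a| ^ n :=
        MeasureTheory.setIntegral_mono_on hf.norm.integrableOn_uIoc hg.integrableOn_uIoc
          measurableSet_uIoc fun s hs => h s (uIoc_subset_uIcc hs)
    _ = C * (|t - a| ^ (n + 1) / (n + 1)) := by
        rw [MeasureTheory.integral_const_mul, integral_pow_abs_sub_uIoc]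

variable {A : ℝ → V →L[ℝ] V} {a : ℝ} {x₀ : V}

theorem norm_dysonTerm_le {K R : ℝ} (hcont : ∀ n, Continuous (dysonTerm A a x₀ n))
    (hA : Continuous A) (hK : ∀ t ∈ Metric.closedBall a R, ‖A t‖ ≤ K) (n : ℕ) :
    ∀ t ∈ Metric.closedBall a R, ‖dysonTerm A a x₀ n t‖ ≤
      ‖x₀‖ * K ^ n / n.factorial * |t - a| ^ n := by
  induction n with
  | zero => simp [dysonTerm]
  | succ n ih =>
    intro t ht
    have hsub : uIcc a t ⊆ Metric.closedBall a R := by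
      rw [← segment_eq_uIcc]
      exact (convex_closedBall a R).segment_subset
        (Metric.mem_closedBall_self (dist_nonneg.trans ht)) ht
    have hK₀ : 0 ≤ K := (norm_nonneg _).trans (hK t ht)
    refine (norm_intervalIntegral_le_of_norm_le_pow (hA.clm_apply (hcont n))
      (C := K * (‖x₀‖ * K ^ n / n.factorial)) (n := n) fun s hs => ?_).trans (le_of_eq ?_)
    · calc _ ≤ ‖A s‖ * ‖dysonTerm A a x₀ n s‖ := (A s).le_opNorm _
        _ ≤ K * (‖x₀‖ * K ^ n / n.factorial * |s - a| ^ n) :=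
            mul_le_mul (hK s (hsub hs)) (ih s (hsub hs)) (norm_nonneg _) hK₀
        _ = _ := by ring
    · rw [Nat.factorial_succ]
      push_cast
      field_simp
      ring

theorem tsum_dysonTerm_self (A : ℝ → V →L[ℝ] V) (a : ℝ) (x₀ : V) :
    ∑' n, dysonTerm A a x₀ n a = x₀ := by
  rw [tsum_eq_single 0]
  · rfl
  · intro n hn
    obtain ⟨m, rfl⟩ := Nat.exists_eq_succ_of_ne_zero hn
    simp [dysonTerm]

variable [CompleteSpace V]

theorem hasDerivAt_dysonTerm_succ (hA : Continuous A) {n : ℕ}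
    (hn : Continuous (dysonTerm A a x₀ n)) (t : ℝ) :
    HasDerivAt (dysonTerm A a x₀ (n + 1)) (A t (dysonTerm A a x₀ n t)) t :=
  (hA.clm_apply hn).integral_hasStrictDerivAt a t |>.hasDerivAt

theorem continuous_dysonTerm (hA : Continuous A) (n : ℕ) :
    Continuous (dysonTerm A a x₀ n) := by
  induction n with
  | zero => exact continuous_const
  | succ n ih =>
    exact continuous_iff_continuousAt.2 fun t => (hasDerivAt_dysonTerm_succ hA ih t).continuousAt

theorem exists_summable_bound_dysonTerm (hA : Continuous A) (a : ℝ) (x₀ : V) (R : ℝ) :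
    ∃ K : ℝ, ∃ u : ℕ → ℝ, Summable u ∧ ∀ t ∈ Metric.ball a R, ‖A t‖ ≤ K ∧
      ∀ n, ‖dysonTerm A a x₀ n t‖ ≤ u n := by
  obtain ⟨K, hK⟩ := (isCompact_closedBall a R).exists_bound_of_continuousOn hA.continuousOn
  refine ⟨K, fun n => ‖x₀‖ * ((K * R) ^ n / n.factorial),
    (Real.summable_pow_div_factorial (K * R)).mul_left _, fun t ht => ?_⟩
  have ht' := Metric.ball_subset_closedBall ht
  refine ⟨hK t ht', fun n => (norm_dysonTerm_le (continuous_dysonTerm hA) hA hK n t ht').trans ?_⟩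
  have hK₀ : 0 ≤ K := (norm_nonneg _).trans (hK t ht')
  have htR : |t - a| ≤ R := ht'
  calc ‖x₀‖ * K ^ n / n.factorial * |t - a| ^ n
      ≤ ‖x₀‖ * K ^ n / n.factorial * R ^ n := by gcongr
    _ = ‖x₀‖ * ((K * R) ^ n / n.factorial) := by ring

theorem summable_dysonTerm (hA : Continuous A) (a : ℝ) (x₀ : V) (t : ℝ) :
    Summable fun n => dysonTerm A a x₀ n t := by
  obtain ⟨K, u, hu, h⟩ := exists_summable_bound_dysonTerm hA a x₀ (dist t a + 1)
  exact hu.of_norm_bounded (h t (lt_add_one (dist t a))).2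

theorem hasDerivAt_tsum_dysonTerm (hA : Continuous A) (a : ℝ) (x₀ : V) (t : ℝ) :
    HasDerivAt (fun t => ∑' n, dysonTerm A a x₀ n t) (A t (∑' n, dysonTerm A a x₀ n t)) t := by
  obtain ⟨K, u, hu, h⟩ := exists_summable_bound_dysonTerm hA a x₀ (dist t a + 1)
  have ht : t ∈ Metric.ball a (dist t a + 1) := lt_add_one (dist t a)
  have hs := summable_dysonTerm hA a x₀
  have key : HasDerivAt (fun t => ∑' n, dysonTerm A a x₀ (n + 1) t)
      (∑' n, A t (dysonTerm A a x₀ n t)) t :=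
    hasDerivAt_tsum_of_isPreconnected (hu.mul_left K) Metric.isOpen_ball
      (convex_ball a _).isPreconnected
      (fun n s _ => hasDerivAt_dysonTerm_succ hA (continuous_dysonTerm hA n) s)
      (fun n s hs => ((A s).le_opNorm _).trans <| mul_le_mul (h s hs).1 ((h s hs).2 n)
        (norm_nonneg _) ((norm_nonneg _).trans (h s hs).1))
      ht ((summable_nat_add_iff 1).2 (hs t)) ht
  rw [(A t).map_tsum (hs t)]
  convert key.const_add x₀ using 1
  ext s
  exact (hs s).tsum_eq_zero_add

end DysonSeries

/-- A cooperative planar linear system keeps the first quadrant invariant, and its second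
coordinate does not decrease there. -/
theorem exists_nonneg_solution_cooperative_system {κ β : ℝ → ℝ} (hκ : Continuous κ)
    (hβ : Continuous β) {a : ℝ} (hκ₀ : ∀ t, a ≤ t → 0 ≤ κ t) (hβ₀ : ∀ t, a ≤ t → 0 ≤ β t)
    {p₀ q₀ : ℝ} (hp₀ : 0 ≤ p₀) (hq₀ : 0 ≤ q₀) :
    ∃ p q : ℝ → ℝ, p a = p₀ ∧ q a = q₀ ∧ (∀ t, HasDerivAt p (κ t * q t) t) ∧
      (∀ t, HasDerivAt q (β t * p t) t) ∧ ∀ t, a ≤ t → 0 ≤ p t ∧ q₀ ≤ q t := by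
  let A : ℝ → ℝ × ℝ →L[ℝ] ℝ × ℝ := fun t =>
    κ t • (ContinuousLinearMap.inl ℝ ℝ ℝ).comp (ContinuousLinearMap.snd ℝ ℝ ℝ) +
      β t • (ContinuousLinearMap.inr ℝ ℝ ℝ).comp (ContinuousLinearMap.fst ℝ ℝ ℝ)
  have hA_apply (t : ℝ) (x : ℝ × ℝ) : A t x = (κ t * x.2, β t * x.1) := by simp [A]
  have hA : Continuous A := by fun_prop
  let T := dysonTerm A a (p₀, q₀)
  have hT₀ (n : ℕ) : ∀ t, a ≤ t → 0 ≤ (T n t).1 ∧ 0 ≤ (T n t).2 := by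
    induction n with
    | zero => exact fun t _ => ⟨hp₀, hq₀⟩
    | succ n ih =>
      intro t ht
      have hint : IntervalIntegrable (fun s => A s (T n s)) MeasureTheory.volume a t :=
        (hA.clm_apply (continuous_dysonTerm hA n)).intervalIntegrable a t
      have h₁ : (T (n + 1) t).1 = ∫ s in a..t, (A s (T n s)).1 :=
        ((ContinuousLinearMap.fst ℝ ℝ ℝ).intervalIntegral_comp_comm hint).symm
      have h₂ : (T (n + 1) t).2 = ∫ s in a..t, (A s (T n s)).2 :=
        ((ContinuousLinearMap.snd ℝ ℝ ℝ).intervalIntegral_comp_comm hint).symm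
      rw [h₁, h₂]
      simp only [hA_apply]
      exact ⟨intervalIntegral.integral_nonneg ht fun s hs =>
          mul_nonneg (hκ₀ s hs.1) (ih s hs.1).2,
        intervalIntegral.integral_nonneg ht fun s hs =>
          mul_nonneg (hβ₀ s hs.1) (ih s hs.1).1⟩
  have hsum := summable_dysonTerm hA a (p₀, q₀)
  have hderiv := hasDerivAt_tsum_dysonTerm hA a (p₀, q₀)
  have hinit := tsum_dysonTerm_self A a (p₀, q₀)
  refine ⟨fun t => (∑' n, T n t).1, fun t => (∑' n, T n t).2, congrArg Prod.fst hinit,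
    congrArg Prod.snd hinit, fun t => ?_, fun t => ?_, fun t ht => ⟨?_, ?_⟩⟩
  · have h := (ContinuousLinearMap.fst ℝ ℝ ℝ).hasFDerivAt.comp_hasDerivAt t (hderiv t)
    rw [hA_apply] at h
    exact h
  · have h := (ContinuousLinearMap.snd ℝ ℝ ℝ).hasFDerivAt.comp_hasDerivAt t (hderiv t)
    rw [hA_apply] at h
    exact h
  · have h := (ContinuousLinearMap.fst ℝ ℝ ℝ).hasSum (hsum t).hasSum
    exact h.nonneg fun n => (hT₀ n t ht).1
  · have h := (ContinuousLinearMap.snd ℝ ℝ ℝ).hasSum (hsum t).hasSum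
    exact le_hasSum h 0 fun n _ => (hT₀ n t ht).2

/-- If `b, c, E` are continuous on `[t₀,∞)` with `b ≥ 0` and `c ≥ 0`, then for
every `t₁ ≥ t₀` and every `γ ≥ 0`, the Riccati equation
`y' + b y² + E y − c = 0` has a solution `y` on all of `[t₁,∞)` with `y(t₁) = γ`
and `y(t) ≥ 0` for all `t ≥ t₁`. -/
theorem riccati_global_nonneg_solution
    (t₀ : ℝ) (b c E : ℝ → ℝ)
    (hb : ContinuousOn b (Ici t₀)) (hc : ContinuousOn c (Ici t₀))
    (hE : ContinuousOn E (Ici t₀))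
    (hbpos : ∀ t ∈ Ici t₀, 0 ≤ b t) (hcpos : ∀ t ∈ Ici t₀, 0 ≤ c t) :
    ∀ t₁ ∈ Ici t₀, ∀ γ : ℝ, 0 ≤ γ →
      ∃ y : ℝ → ℝ, y t₁ = γ ∧
        (∀ t ∈ Ici t₁, HasDerivAt y (-(b t * y t ^ 2) - E t * y t + c t) t) ∧
        ∀ t ∈ Ici t₁, 0 ≤ y t := by
  intro t₁ ht₁ γ hγ
  have extend {f : ℝ → ℝ} (hf : ContinuousOn f (Ici t₀)) :
      Continuous fun t => f (max t₀ t) :=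
    hf.comp_continuous (by fun_prop) fun t => le_max_left t₀ t
  let F : ℝ → ℝ := fun t => ∫ s in t₁..t, E (max t₀ s)
  have hF (t : ℝ) : HasDerivAt F (E (max t₀ t)) t :=
    ((extend hE).integral_hasStrictDerivAt t₁ t).hasDerivAt
  have hF_cont : Continuous F := continuous_iff_continuousAt.2 fun t => (hF t).continuousAt
  obtain ⟨p, q, hp₁, hq₁, hp, hq, hpq⟩ := exists_nonneg_solution_cooperative_system
    (κ := fun t => c (max t₀ t) * Real.exp (F t)) (β := fun t => b (max t₀ t) * Real.exp (-F t))
    ((extend hc).mul (by fun_prop)) ((extend hb).mul (by fun_prop)) (a := t₁)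
    (fun t _ => mul_nonneg (hcpos _ (mem_Ici.2 (le_max_left _ _))) (Real.exp_pos _).le)
    (fun t _ => mul_nonneg (hbpos _ (mem_Ici.2 (le_max_left _ _))) (Real.exp_pos _).le) hγ zero_le_one
  refine ⟨fun t => Real.exp (-F t) * (p t / q t), ?_, fun t ht => ?_, fun t ht => ?_⟩
  · simp [F, hp₁, hq₁]
  · have hq₀ : q t ≠ 0 := (zero_lt_one.trans_le (hpq t ht).2).ne'
    have hmax : max t₀ t = t := max_eq_right (le_trans ht₁ ht)
    have h := (hF t).neg.exp.mul ((hp t).div (hq t) hq₀)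
    refine h.congr_deriv ?_
    have hexp : Real.exp (F t) = (Real.exp (-F t))⁻¹ := by rw [Real.exp_neg, inv_inv]
    have hexp₀ : Real.exp (-F t) ≠ 0 := (Real.exp_pos _).ne'
    simp only [hmax, hexp, Pi.div_apply, Pi.neg_apply]
    field_simp
    ring
  · have := hpq t ht
    exact mul_nonneg (Real.exp_pos _).le (div_nonneg this.1 (zero_le_one.trans this.2))
end

section
/- Let p, q, r be continuous real-valued functions on [t₀,∞) with p(t) > 0 and r(t) ≤ 0 for all t ≥ t₀. Then the equation (p(t)φ')' + q(t)φ' + r(t)φ = 0 has a solution φ on [t₀,∞) that is positive and non-decreasing on [t₀,∞); in particular, the equation is not asymptotically stable (not all of its solutions tend to 0 as t → +∞). -/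
open Set Filter

/-- Iterated integrals from `s₀` with alternating weights `a` and `b`: the terms of the Picard series
of the system `u' = a v`, `v' = b u` with initial value `u = v = 1` at `s₀`. -/
noncomputable def picardTerm (s₀ : ℝ) : ℕ → (ℝ → ℝ) → (ℝ → ℝ) → ℝ → ℝ
  | 0, _, _ => fun _ => 1
  | n + 1, a, b => fun t => ∫ s in s₀..t, a s * picardTerm s₀ n b a s

section PicardSeries

variable {s₀ T K : ℝ} {a b : ℝ → ℝ}

lemma continuous_picardTerm (n : ℕ) (ha : Continuous a) (hb : Continuous b) :
    Continuous (picardTerm s₀ n a b) := by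
  induction n generalizing a b with
  | zero => exact continuous_const
  | succ n ih =>
    exact intervalIntegral.continuous_primitive
      (fun _ _ => (ha.mul (ih hb ha)).intervalIntegrable _ _) _

lemma hasDerivAt_picardTerm_succ (n : ℕ) (ha : Continuous a) (hb : Continuous b) (t : ℝ) :
    HasDerivAt (picardTerm s₀ (n + 1) a b) (a t * picardTerm s₀ n b a t) t :=
  (ha.mul (continuous_picardTerm n hb ha)).integral_hasStrictDerivAt s₀ t |>.hasDerivAt

lemma picardTerm_nonneg (n : ℕ) (ha : ∀ t, 0 ≤ a t) (hb : ∀ t, 0 ≤ b t) {t : ℝ} (ht : s₀ ≤ t) :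
    0 ≤ picardTerm s₀ n a b t := by
  induction n generalizing a b t with
  | zero => exact zero_le_one
  | succ n ih =>
    exact intervalIntegral.integral_nonneg ht fun s hs => mul_nonneg (ha s) (ih hb ha hs.1)

lemma picardTerm_le (n : ℕ) (ha : Continuous a) (hb : Continuous b)
    (ha₀ : ∀ t, 0 ≤ a t) (hb₀ : ∀ t, 0 ≤ b t)
    (haK : ∀ t ∈ Icc s₀ T, a t ≤ K) (hbK : ∀ t ∈ Icc s₀ T, b t ≤ K)
    {t : ℝ} (ht : t ∈ Icc s₀ T) :
    picardTerm s₀ n a b t ≤ (K * (t - s₀)) ^ n / n.factorial := by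
  induction n generalizing a b t with
  | zero => simp [picardTerm]
  | succ n ih =>
    have hK : 0 ≤ K := (ha₀ t).trans (haK t ht)
    have hderiv (s : ℝ) : HasDerivAt
        (fun s => (K * (s - s₀)) ^ (n + 1) / ((n + 1).factorial : ℝ))
        (K * ((K * (s - s₀)) ^ n / n.factorial)) s := by
      have h := ((((hasDerivAt_id s).sub_const s₀).const_mul K).pow (n + 1)).div_const
        ((n + 1).factorial : ℝ)
      refine h.congr_deriv ?_
      have := Nat.factorial_ne_zero n
      simp only [Nat.factorial_succ, id, Nat.cast_mul, Nat.cast_add, Nat.cast_one,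
        Nat.add_sub_cancel, mul_one]
      field_simp
    have hcont : Continuous fun s : ℝ => K * ((K * (s - s₀)) ^ n / (n.factorial : ℝ)) := by
      fun_prop
    calc picardTerm s₀ (n + 1) a b t
        ≤ ∫ s in s₀..t, K * ((K * (s - s₀)) ^ n / (n.factorial : ℝ)) := by
          refine intervalIntegral.integral_mono_on ht.1
            ((ha.mul (continuous_picardTerm n hb ha)).intervalIntegrable _ _)
            (hcont.intervalIntegrable _ _) fun s hs => ?_
          have hs' : s ∈ Icc s₀ T := ⟨hs.1, hs.2.trans ht.2⟩
          exact mul_le_mul (haK s hs') (ih hb ha hb₀ ha₀ hbK haK hs')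
            (picardTerm_nonneg n hb₀ ha₀ hs.1) hK
      _ = (K * (t - s₀)) ^ (n + 1) / (n + 1).factorial := by
          rw [intervalIntegral.integral_eq_sub_of_hasDerivAt (fun s _ => hderiv s)
            (hcont.intervalIntegrable _ _)]
          simp

lemma exists_picardTerm_bound (ha : Continuous a) (hb : Continuous b)
    (ha₀ : ∀ t, 0 ≤ a t) (hb₀ : ∀ t, 0 ≤ b t) (hT : s₀ ≤ T) :
    ∃ K, (∀ t ∈ Icc s₀ T, a t ≤ K) ∧ ∀ n, ∀ t ∈ Icc s₀ T,
      picardTerm s₀ n a b t ≤ (K * (T - s₀)) ^ n / n.factorial ∧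
      picardTerm s₀ n b a t ≤ (K * (T - s₀)) ^ n / n.factorial := by
  obtain ⟨A, hA⟩ := isCompact_Icc.bddAbove_image (K := Icc s₀ T) ha.continuousOn
  obtain ⟨B, hB⟩ := isCompact_Icc.bddAbove_image (K := Icc s₀ T) hb.continuousOn
  have haK : ∀ t ∈ Icc s₀ T, a t ≤ max A B := fun t ht =>
    (hA (mem_image_of_mem a ht)).trans (le_max_left _ _)
  have hbK : ∀ t ∈ Icc s₀ T, b t ≤ max A B := fun t ht =>
    (hB (mem_image_of_mem b ht)).trans (le_max_right _ _)
  have hK : 0 ≤ max A B := (ha₀ s₀).trans (haK s₀ (left_mem_Icc.2 hT))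
  refine ⟨max A B, haK, fun n t ht => ?_⟩
  have hmono : (max A B * (t - s₀)) ^ n / (n.factorial : ℝ)
      ≤ (max A B * (T - s₀)) ^ n / n.factorial := by
    have := sub_nonneg.2 ht.1
    have := ht.2
    gcongr
  exact ⟨(picardTerm_le n ha hb ha₀ hb₀ haK hbK ht).trans hmono,
    (picardTerm_le n hb ha hb₀ ha₀ hbK haK ht).trans hmono⟩

lemma summable_picardTerm (ha : Continuous a) (hb : Continuous b)
    (ha₀ : ∀ t, 0 ≤ a t) (hb₀ : ∀ t, 0 ≤ b t) {t : ℝ} (ht : s₀ ≤ t) :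
    Summable fun n => picardTerm s₀ n a b t := by
  obtain ⟨K, -, hK⟩ := exists_picardTerm_bound ha hb ha₀ hb₀ ht
  exact Summable.of_nonneg_of_le (fun n => picardTerm_nonneg n ha₀ hb₀ ht)
    (fun n => (hK n t (right_mem_Icc.2 ht)).1) (Real.summable_pow_div_factorial _)

lemma one_le_tsum_picardTerm (ha : Continuous a) (hb : Continuous b)
    (ha₀ : ∀ t, 0 ≤ a t) (hb₀ : ∀ t, 0 ≤ b t) {t : ℝ} (ht : s₀ ≤ t) :
    1 ≤ ∑' n, picardTerm s₀ n a b t :=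
  (summable_picardTerm ha hb ha₀ hb₀ ht).le_tsum 0 fun n _ => picardTerm_nonneg n ha₀ hb₀ ht

lemma hasDerivAt_tsum_picardTerm (ha : Continuous a) (hb : Continuous b)
    (ha₀ : ∀ t, 0 ≤ a t) (hb₀ : ∀ t, 0 ≤ b t) {t : ℝ} (ht : s₀ < t) :
    HasDerivAt (fun t => ∑' n, picardTerm s₀ n a b t) (a t * ∑' n, picardTerm s₀ n b a t) t := by
  have hT : s₀ ≤ t + 1 := by linarith
  have htT : t ∈ Ioo s₀ (t + 1) := ⟨ht, by linarith⟩
  obtain ⟨K, haK, hK⟩ := exists_picardTerm_bound ha hb ha₀ hb₀ hT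
  have h : HasDerivAt (fun x => ∑' n, picardTerm s₀ (n + 1) a b x)
      (∑' n, a t * picardTerm s₀ n b a t) t := by
    refine hasDerivAt_tsum_of_isPreconnected
      (u := fun n : ℕ => K * ((K * (t + 1 - s₀)) ^ n / n.factorial))
      ((Real.summable_pow_div_factorial _).mul_left K) isOpen_Ioo isPreconnected_Ioo
      (fun n x _ => hasDerivAt_picardTerm_succ n ha hb x) (fun n x hx => ?_) htT
      ((summable_nat_add_iff 1).2 (summable_picardTerm ha hb ha₀ hb₀ ht.le)) htT
    have hx' := Ioo_subset_Icc_self hx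
    have h0 := picardTerm_nonneg n hb₀ ha₀ hx'.1
    rw [Real.norm_of_nonneg (mul_nonneg (ha₀ x) h0)]
    exact mul_le_mul (haK x hx') (hK n x hx').2 h0 ((ha₀ x).trans (haK x hx'))
  rw [tsum_mul_left] at h
  refine (h.const_add 1).congr_of_eventuallyEq ?_
  filter_upwards [Ioi_mem_nhds ht] with x hx
  exact (summable_picardTerm ha hb ha₀ hb₀ (le_of_lt hx)).tsum_eq_zero_add

end PicardSeries

/-- If `p > 0` and `r ≤ 0` on the whole line, the equation `(p φ')' + q φ' + r φ = 0` has a positive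
solution, with `p φ'` positive, on every half-line `(s₀, ∞)`. -/
lemma exists_pos_solution {p q r : ℝ → ℝ} (hp : Continuous p) (hq : Continuous q)
    (hr : Continuous r) (hppos : ∀ t, 0 < p t) (hrnonpos : ∀ t, r t ≤ 0) (s₀ : ℝ) :
    ∃ φ ψ : ℝ → ℝ, ∀ t, s₀ < t →
      HasDerivAt φ (ψ t / p t) t ∧ HasDerivAt ψ (-(r t * φ t) - (q t / p t) * ψ t) t ∧
      0 < φ t ∧ 0 < ψ t := by
  have hqp : Continuous fun t => q t / p t := hq.div hp fun t => (hppos t).ne'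
  set Q : ℝ → ℝ := fun t => ∫ s in s₀..t, q s / p s
  have hQ (t : ℝ) : HasDerivAt Q (q t / p t) t := (hqp.integral_hasStrictDerivAt s₀ t).hasDerivAt
  have hQc : Continuous Q := continuous_iff_continuousAt.2 fun t => (hQ t).continuousAt
  set a : ℝ → ℝ := fun t => Real.exp (-Q t) / p t
  set b : ℝ → ℝ := fun t => Real.exp (Q t) * -r t
  have ha : Continuous a := (Real.continuous_exp.comp hQc.neg).div hp fun t => (hppos t).ne'
  have hb : Continuous b := (Real.continuous_exp.comp hQc).mul hr.neg
  have ha₀ (t : ℝ) : 0 ≤ a t := div_nonneg (Real.exp_pos _).le (hppos t).le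
  have hb₀ (t : ℝ) : 0 ≤ b t := mul_nonneg (Real.exp_pos _).le (neg_nonneg.2 (hrnonpos t))
  refine ⟨fun t => ∑' n, picardTerm s₀ n a b t,
    fun t => Real.exp (-Q t) * ∑' n, picardTerm s₀ n b a t, fun t ht => ⟨?_, ?_, ?_, ?_⟩⟩
  · convert hasDerivAt_tsum_picardTerm ha hb ha₀ hb₀ ht using 1
    simp only [a]
    ring
  · refine ((hQ t).neg.exp.mul
      (hasDerivAt_tsum_picardTerm hb ha hb₀ ha₀ ht)).congr_deriv ?_
    have hexp : Real.exp (-Q t) * Real.exp (Q t) = 1 := by simp [← Real.exp_add]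
    simp only [b, Pi.neg_apply]
    linear_combination (-r t * ∑' n, picardTerm s₀ n a b t) * hexp
  · exact zero_lt_one.trans_le (one_le_tsum_picardTerm ha hb ha₀ hb₀ ht.le)
  · exact mul_pos (Real.exp_pos _)
      (zero_lt_one.trans_le (one_le_tsum_picardTerm hb ha hb₀ ha₀ ht.le))

/-- **Remark 3.3**. If `p > 0` and `r ≤ 0` (with `q` real-valued), then the
equation `(p φ')' + q φ' + r φ = 0` has a solution which is positive and
non-decreasing on `[t₀,∞)`; in particular the equation is not asymptotically
stable (solutions of the associated system `φ' = ψ/p, ψ' = −r φ − (q/p) ψ`,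
where `ψ = p φ'`, do not all tend to 0 at `+∞`). -/
theorem second_order_not_asymptotically_stable
    (t₀ : ℝ) (p q r : ℝ → ℝ)
    (hp : ContinuousOn p (Ici t₀)) (hq : ContinuousOn q (Ici t₀))
    (hr : ContinuousOn r (Ici t₀))
    (hppos : ∀ t ∈ Ici t₀, 0 < p t) (hrnonpos : ∀ t ∈ Ici t₀, r t ≤ 0) :
    (∃ φ ψ : ℝ → ℝ,
      (∀ t ∈ Ici t₀,
        HasDerivAt φ (ψ t / p t) t ∧
        HasDerivAt ψ (-(r t * φ t) - (q t / p t) * ψ t) t) ∧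
      (∀ t ∈ Ici t₀, 0 < φ t) ∧ MonotoneOn φ (Ici t₀)) ∧
    ¬ (∀ φ ψ : ℝ → ℝ,
      (∀ t ∈ Ici t₀,
        HasDerivAt φ (ψ t / p t) t ∧
        HasDerivAt ψ (-(r t * φ t) - (q t / p t) * ψ t) t) →
      Tendsto φ atTop (nhds 0) ∧ Tendsto ψ atTop (nhds 0)) := by
  have hsol : ∃ φ ψ : ℝ → ℝ,
      (∀ t ∈ Ici t₀,
        HasDerivAt φ (ψ t / p t) t ∧
        HasDerivAt ψ (-(r t * φ t) - (q t / p t) * ψ t) t) ∧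
      (∀ t ∈ Ici t₀, 0 < φ t) ∧ MonotoneOn φ (Ici t₀) := by
    have hmax : Continuous fun t => max t₀ t := continuous_const.max continuous_id
    have hmem (t : ℝ) : max t₀ t ∈ Ici t₀ := mem_Ici.2 (le_max_left _ _)
    obtain ⟨φ, ψ, h⟩ := exists_pos_solution (hp.comp_continuous hmax hmem)
      (hq.comp_continuous hmax hmem) (hr.comp_continuous hmax hmem)
      (fun t => hppos _ (hmem t)) (fun t => hrnonpos _ (hmem t)) (t₀ - 1)
    have h' (t : ℝ) (ht : t ∈ Ici t₀) :
        HasDerivAt φ (ψ t / p t) t ∧ HasDerivAt ψ (-(r t * φ t) - (q t / p t) * ψ t) t ∧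
        0 < φ t ∧ 0 < ψ t := by
      simpa only [Function.comp_apply, max_eq_right (mem_Ici.1 ht)] using h t (by linarith [mem_Ici.1 ht])
    refine ⟨φ, ψ, fun t ht => ⟨(h' t ht).1, (h' t ht).2.1⟩, fun t ht => (h' t ht).2.2.1,
      monotoneOn_of_hasDerivWithinAt_nonneg (f' := fun t => ψ t / p t) (convex_Ici t₀)
        (fun t ht => (h' t ht).1.continuousAt.continuousWithinAt)
        (fun t ht => (h' t (interior_subset ht)).1.hasDerivWithinAt) fun t ht => ?_⟩
    have ht' := interior_subset ht
    exact (div_pos (h' t ht').2.2.2 (hppos t ht')).le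
  refine ⟨hsol, fun hstable => ?_⟩
  obtain ⟨φ, ψ, hφψ, hpos, hmono⟩ := hsol
  have hle : φ t₀ ≤ 0 := ge_of_tendsto (hstable φ ψ hφψ).1 <|
    (eventually_ge_atTop t₀).mono fun t ht => hmono self_mem_Ici ht ht
  exact (hpos t₀ self_mem_Ici).not_ge hle
end

section
/- Let ν and μ be continuous real-valued functions on [e,∞) with μ bounded on [e,∞). If the function t ↦ ∫_{e}^{t} ν(τ) dτ is bounded above on [e,∞), then every solution (φ, ψ) of the linear system φ' = ν(t)φ + (μ(t)/(t ln² t))ψ, ψ' = μ(t)φ + (ν(t) − 1)ψ on [e,∞) is bounded on [e,∞). -/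
open Set Filter

theorem le_of_hasDerivAt_nonpos_Ici {f f' : ℝ → ℝ} {a : ℝ}
    (hf : ∀ t ∈ Ici a, HasDerivAt f (f' t) t) (hf' : ∀ t ∈ Ici a, f' t ≤ 0) :
    ∀ t ∈ Ici a, f t ≤ f a := by
  intro t ht
  refine antitoneOn_of_deriv_nonpos (convex_Ici a)
    (fun s hs => (hf s hs).continuousAt.continuousWithinAt)
    (fun s hs => (hf s (interior_subset hs)).differentiableAt.differentiableWithinAt)
    (fun s hs => ?_) self_mem_Ici ht ht
  rw [(hf s (interior_subset hs)).deriv]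
  exact hf' s (interior_subset hs)

theorem exists_hasDerivAt_eq_integral_of_continuousOn_Ici {ν : ℝ → ℝ} {a : ℝ}
    (hν : ContinuousOn ν (Ici a)) :
    ∃ N : ℝ → ℝ, ∀ t ∈ Ici a, HasDerivAt N (ν t) t ∧ N t = ∫ τ in a..t, ν τ := by
  have hc : Continuous (fun t => ν (max a t)) :=
    hν.comp_continuous (continuous_const.max continuous_id) (fun t => le_max_left a t)
  refine ⟨fun t => ∫ τ in a..t, ν (max a τ), fun t ht => ⟨?_, ?_⟩⟩
  · have h := hc.integral_hasStrictDerivAt a t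
    simpa [max_eq_right (mem_Ici.1 ht)] using h.hasDerivAt
  · refine intervalIntegral.integral_congr fun s hs => ?_
    rw [uIcc_of_le (mem_Ici.1 ht)] at hs
    simp [max_eq_right hs.1]

/-- The system with its common growth factor `exp (∫ ν)` removed has bounded solutions. -/
theorem exists_sq_bound_of_reduced_system {μ x y : ℝ → ℝ} {K : ℝ}
    (hμ : ∀ t ∈ Ici (Real.exp 1), |μ t| ≤ K)
    (hx : ∀ t ∈ Ici (Real.exp 1), HasDerivAt x (μ t / (t * Real.log t ^ 2) * y t) t)
    (hy : ∀ t ∈ Ici (Real.exp 1), HasDerivAt y (μ t * x t - y t) t) :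
    ∃ A B : ℝ, ∀ t ∈ Ici (Real.exp 1), x t ^ 2 ≤ A ∧ y t ^ 2 ≤ B := by
  have hpos : ∀ t ∈ Ici (Real.exp 1), 0 < t ∧ 0 < Real.log t := fun t ht =>
    have h0 : 0 < t := (Real.exp_pos 1).trans_le ht
    ⟨h0, one_pos.trans_le ((Real.le_log_iff_exp_le h0).2 ht)⟩
  have hμ2 : ∀ t ∈ Ici (Real.exp 1), μ t ^ 2 ≤ K ^ 2 := fun t ht =>
    sq_le_sq' (abs_le.1 (hμ t ht)).1 (abs_le.1 (hμ t ht)).2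
  let g : ℝ → ℝ := fun t => (t * Real.log t ^ 2)⁻¹
  let g' : ℝ → ℝ := fun t => -(Real.log t ^ 2 + 2 * Real.log t) / (t * Real.log t ^ 2) ^ 2
  have hg : ∀ t ∈ Ici (Real.exp 1), HasDerivAt g (g' t) t := by
    intro t ht
    obtain ⟨h0, hl⟩ := hpos t ht
    have h := ((hasDerivAt_id' t).mul ((Real.hasDerivAt_log h0.ne').pow 2)).inv
      (by simp only [Pi.mul_apply, Pi.pow_apply]; positivity)
    refine h.congr_deriv ?_
    simp only [g', Pi.mul_apply, Pi.pow_apply]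
    congr 1
    field_simp
    ring
  have hg0 : ∀ t ∈ Ici (Real.exp 1), 0 < g t ∧ g' t ≤ 0 := by
    intro t ht
    obtain ⟨h0, hl⟩ := hpos t ht
    refine ⟨by positivity, ?_⟩
    simp only [g', neg_div]
    rw [neg_nonpos]
    positivity
  have hE : ∀ t ∈ Ici (Real.exp 1), HasDerivAt (fun s => Real.exp (2 * K ^ 2 * (Real.log s)⁻¹))
      (Real.exp (2 * K ^ 2 * (Real.log t)⁻¹) * (2 * K ^ 2 * (-g t))) t := by
    intro t ht
    obtain ⟨h0, hl⟩ := hpos t ht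
    have h := (((Real.hasDerivAt_log h0.ne').inv hl.ne').const_mul (2 * K ^ 2)).exp
    refine h.congr_deriv ?_
    simp only [g, Pi.inv_apply]
    field_simp
  have hV := le_of_hasDerivAt_nonpos_Ici
    (fun t ht => (((hx t ht).pow 2).add ((hg t ht).mul ((hy t ht).pow 2))).mul (hE t ht))
    (by
      intro t ht
      obtain ⟨hgp, hgn⟩ := hg0 t ht
      simp only [Pi.mul_apply, Pi.pow_apply, Pi.add_apply]
      have hd : μ t / (t * Real.log t ^ 2) = μ t * g t := div_eq_mul_inv _ _
      rw [hd]
      have hEp := Real.exp_pos (2 * K ^ 2 * (Real.log t)⁻¹)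
      generalize Real.exp (2 * K ^ 2 * (Real.log t)⁻¹) = E at hEp
      have h1 : 0 ≤ E * (g t * (μ t * x t - y t) ^ 2) := by positivity
      have h2 : 0 ≤ E * (g t * (x t ^ 2 * (K ^ 2 - μ t ^ 2))) := by
        have := sub_nonneg.2 (hμ2 t ht)
        positivity
      have h3 : 0 ≤ E * (-g' t * y t ^ 2) := by
        have := neg_nonneg.2 hgn
        positivity
      have h4 : 0 ≤ E * (K ^ 2 * g t * (g t * y t ^ 2)) := by positivity
      push_cast
      norm_num
      nlinarith)
  simp only [Pi.mul_apply, Pi.pow_apply, Pi.add_apply] at hV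
  obtain ⟨A, hA⟩ : ∃ A, ∀ t ∈ Ici (Real.exp 1), x t ^ 2 ≤ A := by
    refine ⟨_, fun t ht => le_trans ?_ (hV t ht)⟩
    obtain ⟨h0, hl⟩ := hpos t ht
    have hE1 : 1 ≤ Real.exp (2 * K ^ 2 * (Real.log t)⁻¹) := Real.one_le_exp (by positivity)
    have h1 : 0 ≤ g t * y t ^ 2 := mul_nonneg (hg0 t ht).1.le (sq_nonneg _)
    nlinarith [sq_nonneg (x t)]
  have hY := le_of_hasDerivAt_nonpos_Ici
    (fun t ht => (((hy t ht).pow 2).sub_const (K ^ 2 * A)).mul (Real.hasDerivAt_exp t))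
    (by
      intro t ht
      simp only [Pi.pow_apply]
      have h1 : μ t ^ 2 * x t ^ 2 ≤ K ^ 2 * A :=
        mul_le_mul (hμ2 t ht) (hA t ht) (sq_nonneg _) (sq_nonneg _)
      rw [← add_mul]
      refine mul_nonpos_of_nonpos_of_nonneg ?_ (Real.exp_pos t).le
      push_cast
      norm_num
      nlinarith [sq_nonneg (μ t * x t - y t)])
  simp only [Pi.mul_apply, Pi.pow_apply] at hY
  refine ⟨A, K ^ 2 * A + |(y (Real.exp 1) ^ 2 - K ^ 2 * A) * Real.exp (Real.exp 1)|,
    fun t ht => ⟨hA t ht, ?_⟩⟩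
  have h1 := (hY t ht).trans (le_abs_self _)
  have h2 : 1 ≤ Real.exp t := Real.one_le_exp (hpos t ht).1.le
  by_contra! h
  have h3 := abs_nonneg ((y (Real.exp 1) ^ 2 - K ^ 2 * A) * Real.exp (Real.exp 1))
  nlinarith



/-- **Example 3.1, stability part**. If `μ` is bounded on `[e,∞)` and
`t ↦ ∫_e^t ν(τ) dτ` is bounded above on `[e,∞)`, then every solution of the
system `φ' = ν φ + (μ/(t ln² t)) ψ, ψ' = μ φ + (ν − 1) ψ` is bounded on `[e,∞)`. -/
theorem example_system_lyapunov_stable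
    (ν μ : ℝ → ℝ)
    (hν : ContinuousOn ν (Ici (Real.exp 1))) (hμ : ContinuousOn μ (Ici (Real.exp 1)))
    (hμbdd : ∃ K : ℝ, ∀ t ∈ Ici (Real.exp 1), |μ t| ≤ K)
    (hνint : ∃ K : ℝ, ∀ t ∈ Ici (Real.exp 1), (∫ τ in (Real.exp 1)..t, ν τ) ≤ K) :
    ∀ φ ψ : ℝ → ℝ,
      (∀ t ∈ Ici (Real.exp 1),
        HasDerivAt φ (ν t * φ t + μ t / (t * Real.log t ^ 2) * ψ t) t ∧
        HasDerivAt ψ (μ t * φ t + (ν t - 1) * ψ t) t) →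
      ∃ M : ℝ, ∀ t ∈ Ici (Real.exp 1), |φ t| ≤ M ∧ |ψ t| ≤ M := by
  intro φ ψ h
  obtain ⟨K, hK⟩ := hμbdd
  obtain ⟨L, hL⟩ := hνint
  obtain ⟨N, hN⟩ := exists_hasDerivAt_eq_integral_of_continuousOn_Ici hν
  obtain ⟨A, B, hAB⟩ := exists_sq_bound_of_reduced_system
    (x := fun t => φ t * Real.exp (-N t)) (y := fun t => ψ t * Real.exp (-N t)) hK
    (fun t ht => ((h t ht).1.mul (hN t ht).1.neg.exp).congr_deriv (by simp; ring))
    (fun t ht => ((h t ht).2.mul (hN t ht).1.neg.exp).congr_deriv (by simp; ring))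
  have hbound : ∀ t ∈ Ici (Real.exp 1), ∀ u C : ℝ, (u * Real.exp (-N t)) ^ 2 ≤ C →
      |u| ≤ √C * Real.exp L := by
    intro t ht u C hu
    have h1 := Real.abs_le_sqrt hu
    have hNL : Real.exp (N t) ≤ Real.exp L := by
      rw [Real.exp_le_exp, (hN t ht).2]
      exact hL t ht
    calc |u| = |u * Real.exp (-N t)| * Real.exp (N t) := by
          rw [abs_mul, Real.abs_exp, mul_assoc, ← Real.exp_add, neg_add_cancel, Real.exp_zero,
            mul_one]
      _ ≤ √C * Real.exp L := by gcongr
  exact ⟨max (√A * Real.exp L) (√B * Real.exp L), fun t ht =>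
    ⟨(hbound t ht _ _ (hAB t ht).1).trans (le_max_left _ _),
      (hbound t ht _ _ (hAB t ht).2).trans (le_max_right _ _)⟩⟩
end

section
/- Let ν and μ be continuous real-valued functions on [e,∞) with μ bounded on [e,∞). Suppose there exists ε ∈ (0,1) such that the function t ↦ ∫_{e}^{t} (ν(τ) + ε) dτ is bounded above on [e,∞) (so that in particular ∫_{e}^{t} ν(τ) dτ → −∞ as t → +∞). Then every solution (φ, ψ) of the linear system φ' = ν(t)φ + (μ(t)/(t ln² t))ψ, ψ' = μ(t)φ + (ν(t) − 1)ψ on [e,∞) tends to (0,0) as t → +∞. -/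
open Set Filter

/-- The primitive from `a` of a function continuous on `[a,∞)` has the expected derivative at
every point of `(a,∞)`. -/
theorem hasDerivAt_primitive_of_continuousOn_Ici {f : ℝ → ℝ} {a t : ℝ}
    (hf : ContinuousOn f (Ici a)) (ht : a < t) :
    HasDerivAt (fun s => ∫ τ in a..s, f τ) (f t) t := by
  refine intervalIntegral.integral_hasDerivAt_right ?_ ?_ (hf.continuousAt (Ici_mem_nhds ht))
  · refine ContinuousOn.intervalIntegrable (hf.mono ?_)
    rw [uIcc_of_le ht.le]
    exact Icc_subset_Ici_self
  · exact (hf.mono Ioi_subset_Ici_self).stronglyMeasurableAtFilter isOpen_Ioi t ht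

/-- The quadratic form controlling the derivative of the Lyapunov function is nonpositive. -/
theorem lyapunov_form_nonpos {K ε δ g m x y : ℝ} (hm : |m| ≤ K) (hδ : 0 < δ)
    (hg0 : 0 ≤ g) (hgδ : g ≤ δ) (hε : 0 < ε) (hKδ : 2 * K ^ 2 * δ ≤ ε) :
    2 * m * (g + δ) * (x * y) - 2 * δ * y ^ 2 - ε * x ^ 2 - ε * δ * y ^ 2 ≤ 0 := by
  have hcoef : |m * (g + δ)| ≤ K * (2 * δ) := by
    rw [abs_mul, abs_of_nonneg (by linarith : 0 ≤ g + δ)]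
    exact mul_le_mul hm (by linarith) (by linarith) ((abs_nonneg m).trans hm)
  have hsq : (m * (g + δ)) ^ 2 ≤ 2 * δ * ε := by
    calc (m * (g + δ)) ^ 2 = |m * (g + δ)| ^ 2 := (sq_abs _).symm
      _ ≤ (K * (2 * δ)) ^ 2 := pow_le_pow_left₀ (abs_nonneg _) hcoef 2
      _ = 2 * δ * (2 * K ^ 2 * δ) := by ring
      _ ≤ 2 * δ * ε := by gcongr
  have hmain : 2 * (m * (g + δ)) * (x * y) ≤ 2 * δ * y ^ 2 + ε * x ^ 2 := by
    refine le_of_mul_le_mul_left ?_ hε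
    nlinarith [sq_nonneg (ε * x - m * (g + δ) * y),
      mul_le_mul_of_nonneg_right hsq (sq_nonneg y)]
  nlinarith [mul_nonneg (mul_nonneg hε.le hδ.le) (sq_nonneg y)]

/-- **Example 3.1, asymptotic stability part**. If `μ` is bounded on `[e,∞)` and
for some `ε ∈ (0,1)` the function `t ↦ ∫_e^t (ν(τ) + ε) dτ` is bounded above on
`[e,∞)`, then every solution of the system
`φ' = ν φ + (μ/(t ln² t)) ψ, ψ' = μ φ + (ν − 1) ψ` tends to `(0,0)` as `t → +∞`. -/
theorem example_system_asymptotically_stable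
    (ν μ : ℝ → ℝ)
    (hν : ContinuousOn ν (Ici (Real.exp 1))) (hμ : ContinuousOn μ (Ici (Real.exp 1)))
    (hμbdd : ∃ K : ℝ, ∀ t ∈ Ici (Real.exp 1), |μ t| ≤ K)
    (hνint : ∃ ε : ℝ, ε ∈ Ioo (0 : ℝ) 1 ∧
      ∃ K : ℝ, ∀ t ∈ Ici (Real.exp 1), (∫ τ in (Real.exp 1)..t, (ν τ + ε)) ≤ K) :
    ∀ φ ψ : ℝ → ℝ,
      (∀ t ∈ Ici (Real.exp 1),
        HasDerivAt φ (ν t * φ t + μ t / (t * Real.log t ^ 2) * ψ t) t ∧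
        HasDerivAt ψ (μ t * φ t + (ν t - 1) * ψ t) t) →
      Tendsto φ atTop (nhds 0) ∧ Tendsto ψ atTop (nhds 0) := by
  obtain ⟨K, hK⟩ := hμbdd
  obtain ⟨ε, ⟨hε, -⟩, L, hL⟩ := hνint
  intro φ ψ hsol
  obtain ⟨δ, hδ, hKδ⟩ : ∃ δ : ℝ, 0 < δ ∧ 2 * K ^ 2 * δ ≤ ε := by
    refine ⟨ε / (2 * K ^ 2 + 1), by positivity, ?_⟩
    rw [← mul_div_assoc, div_le_iff₀ (by positivity)]
    nlinarith
  set I : ℝ → ℝ := fun t => ∫ τ in (Real.exp 1)..t, (ν τ + ε) with hI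
  set W : ℝ → ℝ := fun t => (φ t ^ 2 + δ * ψ t ^ 2) * Real.exp (ε * t - 2 * I t) with hW
  set T : ℝ := max (Real.exp 1 + 1) δ⁻¹
  have heT : ∀ t ∈ Ici T, Real.exp 1 < t := fun t ht => by
    have : Real.exp 1 + 1 ≤ t := (le_max_left _ _).trans ht
    linarith
  have hderiv : ∀ t ∈ Ici T, HasDerivAt W
      ((2 * μ t * (1 / (t * Real.log t ^ 2) + δ) * (φ t * ψ t) - 2 * δ * ψ t ^ 2
        - ε * φ t ^ 2 - ε * δ * ψ t ^ 2) * Real.exp (ε * t - 2 * I t)) t := by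
    intro t ht
    obtain ⟨hφ, hψ⟩ := hsol t (heT t ht).le
    have hIt : HasDerivAt I (ν t + ε) t :=
      hasDerivAt_primitive_of_continuousOn_Ici (hν.add continuousOn_const) (heT t ht)
    have hexp := (((hasDerivAt_id t).const_mul ε).sub (hIt.const_mul 2)).exp
    refine (((hφ.pow 2).add ((hψ.pow 2).const_mul δ)).mul hexp).congr_deriv ?_
    simp only [Pi.add_apply, Pi.sub_apply, Pi.pow_apply, id]
    ring
  have hanti : AntitoneOn W (Ici T) := by
    refine antitoneOn_of_deriv_nonpos (convex_Ici T)
      (fun t ht => (hderiv t ht).continuousAt.continuousWithinAt)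
      (fun t ht => (hderiv t (interior_subset ht)).differentiableAt.differentiableWithinAt) ?_
    intro t ht
    replace ht := interior_subset ht
    rw [(hderiv t ht).deriv]
    have het := heT t ht
    have ht0 : 0 < t := (Real.exp_pos 1).trans het
    have hlog : 1 ≤ Real.log t := (Real.le_log_iff_exp_le ht0).2 het.le
    have hδt : δ⁻¹ ≤ t := (le_max_right _ _).trans ht
    have hg : 1 / (t * Real.log t ^ 2) ≤ δ := by
      rw [one_div]
      refine inv_le_of_inv_le₀ hδ (hδt.trans ?_)
      nlinarith [one_le_pow₀ hlog (n := 2)]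
    exact mul_nonpos_of_nonpos_of_nonneg
      (lyapunov_form_nonpos (hK t het.le) hδ (by positivity) hg hε hKδ) (Real.exp_pos _).le
  have hbound : ∀ t ∈ Ici T,
      φ t ^ 2 + δ * ψ t ^ 2 ≤ W T * Real.exp (2 * L) * Real.exp (-(ε * t)) := by
    intro t ht
    have hWT : 0 ≤ W T := by positivity
    calc φ t ^ 2 + δ * ψ t ^ 2 = W t * Real.exp (2 * I t - ε * t) := by
          rw [hW, mul_assoc, ← Real.exp_add]
          simp
      _ ≤ W T * Real.exp (2 * L + -(ε * t)) := by
          refine mul_le_mul (hanti self_mem_Ici ht ht) (Real.exp_le_exp.2 ?_)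
            (Real.exp_pos _).le hWT
          have := hL t (heT t ht).le
          simp only [hI]
          linarith
      _ = _ := by rw [Real.exp_add, ← mul_assoc]
  have hdecay : Tendsto (fun t => W T * Real.exp (2 * L) * Real.exp (-(ε * t))) atTop (nhds 0) := by
    have h := (Real.tendsto_exp_neg_atTop_nhds_zero.comp
      (tendsto_id.const_mul_atTop hε)).const_mul (W T * Real.exp (2 * L))
    simpa using h
  have hφ2 : Tendsto (fun t => φ t ^ 2) atTop (nhds 0) := by
    refine squeeze_zero' (.of_forall fun t => sq_nonneg _) ?_ hdecay
    filter_upwards [Ici_mem_atTop T] with t ht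
    nlinarith [hbound t ht, mul_nonneg hδ.le (sq_nonneg (ψ t))]
  have hψ2 : Tendsto (fun t => δ * ψ t ^ 2) atTop (nhds 0) := by
    refine squeeze_zero' (.of_forall fun t => by positivity) ?_ hdecay
    filter_upwards [Ici_mem_atTop T] with t ht
    nlinarith [hbound t ht, sq_nonneg (φ t)]
  have hψ2' : Tendsto (fun t => ψ t ^ 2) atTop (nhds 0) := by
    simpa [hδ.ne'] using hψ2.const_mul δ⁻¹
  have hroot : ∀ f : ℝ → ℝ, Tendsto (fun t => f t ^ 2) atTop (nhds 0) →
      Tendsto f atTop (nhds 0) := fun f hf => by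
    have h := hf.sqrt
    simp only [Real.sqrt_sq_eq_abs, Real.sqrt_zero] at h
    exact (tendsto_zero_iff_abs_tendsto_zero f).2 h
  exact ⟨hroot φ hφ2, hroot ψ hψ2'⟩
end
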